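/- Consider any σ_*, σ'_* ∈ S_*(1/(4Q)). There exist constants c_G, C_G > 0 depending only on G such that for all large enough n, for every a ∈ G, every ρ ∈ G^*, every t ≥ 0, and every R > 0, the product replacement chain started at σ'_* satisfies Pr_{σ'_*}(‖y^{σ_*}_{a,ρ}(t)‖_HS ≥ R·(1/√n + e^{−t/n}·‖y^{σ_*}_{a,ρ}(0)‖_HS)) ≤ C_G·e^{−c_G·R²} + 2/n³. -/

import Mathlib

open scoped BigOperators
open Filter

attribute [local instance] Classical.propDecidable

noncomputable section

namespace PR

variable (G : Type) [Group G] [Fintype G]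

/-- A configuration: an `n`-tuple of elements of `G`. -/
abbrev Config (n : ℕ) := Fin n → G

/-- The set of generating `n`-tuples. -/
def gens (n : ℕ) : Set (Config G n) :=
  {σ | Subgroup.closure (Set.range σ) = ⊤}

/-- A move of the product replacement chain: an ordered pair of distinct indices
together with a sign (`true` = multiply, `false` = multiply by inverse). -/
abbrev Move (n : ℕ) := {p : Fin n × Fin n // p.1 ≠ p.2} × Bool

/-- Applying a move: replace `σ i` by `σ i * (σ j)^{±1}`. -/
def applyMove {n : ℕ} (σ : Config G n) (m : Move n) : Config G n :=
  Function.update σ m.1.1.1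
    (σ m.1.1.1 * (if m.2 then σ m.1.1.2 else (σ m.1.1.2)⁻¹))

/-- One-step transition probability of the product replacement chain. -/
def step {n : ℕ} (σ σ' : Config G n) : ℝ :=
  ((Finset.univ.filter (fun m : Move n => applyMove G σ m = σ')).card : ℝ) /
    (Fintype.card (Move n) : ℝ)

/-- The law of `σ_t` for the chain started at `σ₀`. -/
def law {n : ℕ} (σ₀ : Config G n) : ℕ → Config G n → ℝ
  | 0 => fun σ' => if σ' = σ₀ then 1 else 0
  | (t + 1) => fun σ' => ∑ τ : Config G n, law σ₀ t τ * step G τ σ'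

/-- Probability that `σ_t ∈ E` for the chain started at `σ₀`. -/
def prob {n : ℕ} (σ₀ : Config G n) (t : ℕ) (E : Set (Config G n)) : ℝ :=
  ∑ τ ∈ Finset.univ.filter (fun τ => τ ∈ E), law G σ₀ t τ

/-- Probability of a trajectory event for the chain started at `σ₀`, over the
time horizon `{0, 1, …, T}`. -/
def pathProb {n : ℕ} (σ₀ : Config G n) (T : ℕ)
    (E : Set (Fin (T + 1) → Config G n)) : ℝ :=
  ∑ p ∈ Finset.univ.filter
      (fun p : Fin (T + 1) → Config G n => p 0 = σ₀ ∧ p ∈ E),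
    ∏ t : Fin T, step G (p t.castSucc) (p t.succ)

/-- `n_a(σ)`: the number of sites holding the group element `a`. -/
def nCount {n : ℕ} (σ : Config G n) (a : G) : ℕ :=
  (Finset.univ.filter (fun i => σ i = a)).card

/-- `n^H_non(σ)`: the number of sites whose element lies outside `H`. -/
def nNon {n : ℕ} (H : Subgroup G) (σ : Config G n) : ℕ :=
  (Finset.univ.filter (fun i => σ i ∉ H)).card

/-- `n^{id}_non(σ)`: the number of sites not holding the identity. -/
def nNonId {n : ℕ} (σ : Config G n) : ℕ :=
  (Finset.univ.filter (fun i => σ i ≠ 1)).card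

/-- `S_non(c)`. -/
def SNon (n : ℕ) (c : ℝ) : Set (Config G n) :=
  {σ | σ ∈ gens G n ∧
    ∀ H : Subgroup G, H ≠ ⊤ → c * n ≤ (nNon G H σ : ℝ)}

/-- The `δ`-typical set `S_*(δ)`. -/
def SAst (n : ℕ) (δ : ℝ) : Set (Config G n) :=
  {σ | σ ∈ gens G n ∧
    Real.sqrt (∑ a : G, ((nCount G σ a : ℝ) / n - 1 / (Fintype.card G : ℝ)) ^ 2) ≤ δ}

/-- `n^{σ₀}_{a,b}(σ)`. -/
def nab {n : ℕ} (σ₀ σ : Config G n) (a b : G) : ℕ :=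
  (Finset.univ.filter (fun i => σ₀ i = a ∧ σ i = b)).card

/-- `S_*(σ₀, r)`. -/
def SAstM {n : ℕ} (σ₀ : Config G n) (r : ℝ) : Set (Config G n) :=
  {σ | σ ∈ gens G n ∧
    ∀ a : G, Real.sqrt (∑ b : G,
      ((nab G σ₀ σ a b : ℝ) / (nCount G σ₀ a : ℝ) - 1 / (Fintype.card G : ℝ)) ^ 2) ≤ r}

/-- The uniform stationary distribution `π` on the set of generating tuples. -/
def statDist (n : ℕ) : Config G n → ℝ := fun σ =>
  if σ ∈ gens G n then
    1 / ((Finset.univ.filter (fun τ : Config G n => τ ∈ gens G n)).card : ℝ)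
  else 0

/-- Total-variation distance between two (finitely supported) signed weights,
as the supremum over finite sets `A` of `|p(A) - q(A)|`. -/
def tvDist {α : Type*} (p q : α → ℝ) : ℝ :=
  sSup {x : ℝ | ∃ A : Finset α, x = |∑ a ∈ A, p a - ∑ a ∈ A, q a|}

/-- `d_σ(t) = max_{A ⊆ S} |P_σ(σ_t ∈ A) - π(A)|`. -/
def dTV {n : ℕ} (σ : Config G n) (t : ℕ) : ℝ :=
  sSup {x : ℝ | ∃ A : Finset (Config G n), ↑A ⊆ gens G n ∧
    x = |∑ τ ∈ A, law G σ t τ - ∑ τ ∈ A, statDist G n τ|}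

/-- `max_{σ ∈ S} d_σ(t)`. -/
def dMax (n : ℕ) (t : ℕ) : ℝ :=
  sSup {x : ℝ | ∃ σ ∈ gens G n, x = dTV G σ t}

end PR

namespace PR

variable (G : Type) [Group G] [Fintype G]

/-- A unitary representation of `G` of dimension `d`, as a monoid homomorphism into the
unitary group of `d × d` complex matrices. -/
abbrev UnitaryRep (d : ℕ) := G →* Matrix.unitaryGroup (Fin d) ℂ

/-- A representation is non-trivial if some group element acts non-trivially. -/
def IsNontrivialRep {d : ℕ} (ρ : UnitaryRep G d) : Prop :=
  ∃ a : G, ((ρ a : Matrix (Fin d) (Fin d) ℂ)) ≠ 1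

/-- Irreducibility: the only invariant subspaces are `⊥` and `⊤`. -/
def IsIrreducibleRep {d : ℕ} (ρ : UnitaryRep G d) : Prop :=
  ∀ W : Submodule ℂ (Fin d → ℂ),
    (∀ a : G, ∀ w ∈ W, ((ρ a : Matrix (Fin d) (Fin d) ℂ)).mulVec w ∈ W) →
    W = ⊥ ∨ W = ⊤

/-- Hilbert–Schmidt norm of a complex matrix. -/
def hsNorm {d : ℕ} (A : Matrix (Fin d) (Fin d) ℂ) : ℝ :=
  Real.sqrt (∑ i : Fin d, ∑ j : Fin d, ‖A i j‖ ^ 2)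

/-- Operator norm (`ℓ² → ℓ²`) of a complex matrix. -/
def opNorm {d : ℕ} (A : Matrix (Fin d) (Fin d) ℂ) : ℝ :=
  ‖LinearMap.toContinuousLinearMap (Matrix.toEuclideanLin A)‖

/-- The Fourier coefficient `x_ρ(σ) = Σ_a (n_a(σ)/n) ρ(a)`. -/
def xCoeff {n d : ℕ} (ρ : UnitaryRep G d) (σ : Config G n) :
    Matrix (Fin d) (Fin d) ℂ :=
  ∑ a : G, (((nCount G σ a : ℝ) / (n : ℝ) : ℝ) : ℂ) • (ρ a : Matrix (Fin d) (Fin d) ℂ)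

/-- `X_ρ(σ) = (1/(n−1)) ((x_ρ(σ) + x_ρ(σ)^*)/2 − ((n−1)/n) I)`. -/
def XMat {n d : ℕ} (ρ : UnitaryRep G d) (σ : Config G n) :
    Matrix (Fin d) (Fin d) ℂ :=
  (((n : ℂ) - 1)⁻¹) •
    ((xCoeff G ρ σ + star (xCoeff G ρ σ)) / 2 - (((n : ℂ) - 1) / (n : ℂ)) • (1 : Matrix (Fin d) (Fin d) ℂ))

/-- The Fourier coefficient `y^{σ_*}_{a,ρ}(σ) = Σ_b (n^{σ_*}_{a,b}(σ)/n_a(σ_*)) ρ(b)`. -/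
def yCoeff {n d : ℕ} (ρ : UnitaryRep G d) (σast σ : Config G n) (a : G) :
    Matrix (Fin d) (Fin d) ℂ :=
  ∑ b : G, (((nab G σast σ a b : ℝ) / (nCount G σast a : ℝ) : ℝ) : ℂ) •
    (ρ b : Matrix (Fin d) (Fin d) ℂ)

end PR

set_option linter.unusedSectionVars false

namespace PR

section Chain

variable {G : Type} [Group G] [Fintype G] {n : ℕ}

theorem sum_step_mul (σ : Config G n) (g : Config G n → ℝ) :
    ∑ σ', step G σ σ' * g σ' =
      (∑ m : Move n, g (applyMove G σ m)) / (Fintype.card (Move n) : ℝ) := by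
  have h : ∀ σ' : Config G n, step G σ σ' * g σ' =
      (∑ m : Move n, if applyMove G σ m = σ' then g σ' else 0) / (Fintype.card (Move n) : ℝ) := by
    intro σ'
    rw [step, Finset.sum_ite, Finset.sum_const_zero, add_zero, Finset.sum_const, nsmul_eq_mul]
    ring
  rw [Finset.sum_congr rfl fun σ' _ => h σ', ← Finset.sum_div, Finset.sum_comm]
  simp

theorem card_move : Fintype.card (Move n) = n * (n - 1) * 2 := by
  have h : Fintype.card {p : Fin n × Fin n // p.1 ≠ p.2} = n * (n - 1) := by
    rw [Fintype.card_subtype]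
    have := Finset.offDiag_card (s := (Finset.univ : Finset (Fin n)))
    rw [Finset.card_univ, Fintype.card_fin] at this
    rw [Nat.mul_sub, mul_one, ← this]
    congr 1
    ext p
    simp [Finset.mem_offDiag]
  rw [Fintype.card_prod, h, Fintype.card_bool]

theorem card_move_cast (hn : 2 ≤ n) :
    (Fintype.card (Move n) : ℝ) = 2 * n * (n - 1) := by
  rw [card_move]
  push_cast [Nat.cast_sub (show 1 ≤ n by omega)]
  ring

theorem card_move_pos (hn : 2 ≤ n) : (0 : ℝ) < Fintype.card (Move n) := by
  rw [card_move_cast hn]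
  have : (2 : ℝ) ≤ n := by exact_mod_cast hn
  nlinarith

theorem step_nonneg (σ σ' : Config G n) : 0 ≤ step G σ σ' := by
  unfold step; positivity

theorem sum_step (hn : 2 ≤ n) (σ : Config G n) : ∑ σ', step G σ σ' = 1 := by
  have := sum_step_mul σ (fun _ => 1)
  simp only [mul_one, Finset.sum_const, nsmul_eq_mul, Finset.card_univ] at this
  rw [this, div_self (card_move_pos hn).ne']

theorem law_nonneg (σ : Config G n) (t : ℕ) (τ : Config G n) : 0 ≤ law G σ t τ := by
  induction t generalizing τ with
  | zero => simp only [law]; split_ifs <;> norm_num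
  | succ t ih => exact Finset.sum_nonneg fun ρ _ => mul_nonneg (ih ρ) (step_nonneg _ _)

theorem sum_law (hn : 2 ≤ n) (σ : Config G n) (t : ℕ) : ∑ τ, law G σ t τ = 1 := by
  induction t with
  | zero => simp [law]
  | succ t ih =>
    simp only [law]
    rw [Finset.sum_comm]
    simp only [← Finset.mul_sum, sum_step hn, mul_one, ih]

theorem applyMove_flip (σ : Config G n) (m : Move n) :
    applyMove G (applyMove G σ m) (m.1, !m.2) = σ := by
  obtain ⟨⟨⟨i, j⟩, hij⟩, b⟩ := m
  have hji : j ≠ i := fun h => hij h.symm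
  funext l
  by_cases hl : l = i
  · subst hl
    cases b <;> simp [applyMove, Function.update_of_ne hji]
  · simp [applyMove, Function.update_of_ne hl]

theorem step_symm (σ σ' : Config G n) : step G σ σ' = step G σ' σ := by
  unfold step
  congr 2
  refine Finset.card_bij' (fun m _ => (m.1, !m.2)) (fun m _ => (m.1, !m.2)) ?_ ?_ ?_ ?_
  · intro m hm
    simp only [Finset.mem_filter, Finset.mem_univ, true_and] at hm ⊢
    rw [← hm, applyMove_flip]
  · intro m hm
    simp only [Finset.mem_filter, Finset.mem_univ, true_and] at hm ⊢
    rw [← hm, applyMove_flip]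
  · intro m _; simp
  · intro m _; simp

theorem sum_law_start (hn : 2 ≤ n) (t : ℕ) (τ : Config G n) : ∑ σ, law G σ t τ = 1 := by
  induction t generalizing τ with
  | zero => simp [law]
  | succ t ih =>
    simp only [law]
    rw [Finset.sum_comm]
    simp only [← Finset.sum_mul, ih, one_mul]
    simp only [step_symm _ τ, sum_step hn]

/-- Relabelling the sites of a move. -/
def moveEquiv (π : Equiv.Perm (Fin n)) : Move n ≃ Move n :=
  Equiv.prodCongr ((Equiv.prodCongr π π).subtypeEquiv fun p => by
    simp [π.injective.eq_iff]) (Equiv.refl _)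

theorem applyMove_comp_perm (π : Equiv.Perm (Fin n)) (σ : Config G n) (m : Move n) :
    applyMove G (σ ∘ π) m = applyMove G σ (moveEquiv π m) ∘ π := by
  funext l
  by_cases hl : l = m.1.1.1
  · subst hl
    simp [applyMove, moveEquiv]
  · have : π l ≠ π m.1.1.1 := fun h => hl (π.injective h)
    simp [applyMove, moveEquiv, Function.update_of_ne hl, Function.update_of_ne this]

theorem step_comp_perm (π : Equiv.Perm (Fin n)) (σ τ : Config G n) :
    step G (σ ∘ π) (τ ∘ π) = step G σ τ := by
  unfold step
  congr 2
  refine Finset.card_equiv (moveEquiv π) fun m => ?_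
  simp only [Finset.mem_filter, Finset.mem_univ, true_and, applyMove_comp_perm]
  exact π.surjective.injective_comp_right.eq_iff

theorem law_comp_perm (π : Equiv.Perm (Fin n)) (σ τ : Config G n) (t : ℕ) :
    law G (σ ∘ π) t (τ ∘ π) = law G σ t τ := by
  induction t generalizing τ with
  | zero => simp only [law, π.surjective.injective_comp_right.eq_iff]
  | succ t ih =>
    simp only [law]
    rw [← (π.symm.arrowCongr (Equiv.refl G)).sum_comp]
    refine Finset.sum_congr rfl fun ρ _ => ?_
    have : (π.symm.arrowCongr (Equiv.refl G)) ρ = ρ ∘ π := by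
      funext l; simp [Equiv.arrowCongr]
    rw [this, ih, step_comp_perm]

end Chain

end PR

namespace PR

section Killed

variable {G : Type} [Group G] [Fintype G] {n : ℕ}

/-- Evolution of the weight `w` under the chain, where the mass sitting in `B s` at time `s`
is removed. -/
def killed (w : Config G n → ℝ) (B : ℕ → Set (Config G n)) : ℕ → Config G n → ℝ
  | 0 => w
  | s + 1 => fun σ' => ∑ τ, (if τ ∈ B s then 0 else killed w B s τ) * step G τ σ'

variable {w : Config G n → ℝ} {B : ℕ → Set (Config G n)}

theorem killed_nonneg (hw : ∀ τ, 0 ≤ w τ) (s : ℕ) (τ : Config G n) : 0 ≤ killed w B s τ := by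
  induction s generalizing τ with
  | zero => exact hw τ
  | succ s ih =>
    refine Finset.sum_nonneg fun ρ _ => mul_nonneg ?_ (step_nonneg _ _)
    split_ifs
    exacts [le_rfl, ih ρ]

theorem killed_le_law (σ : Config G n) (t s : ℕ) (τ : Config G n) :
    killed (law G σ t) B s τ ≤ law G σ (t + s) τ := by
  induction s generalizing τ with
  | zero => exact le_rfl
  | succ s ih =>
    refine Finset.sum_le_sum fun ρ _ => mul_le_mul_of_nonneg_right ?_ (step_nonneg _ _)
    split_ifs
    exacts [law_nonneg _ _ _, ih ρ]

theorem sum_law_sub_killed_le (hn : 2 ≤ n) (σ : Config G n) (t s : ℕ) :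
    ∑ τ, (law G σ (t + s) τ - killed (law G σ t) B s τ) ≤
      ∑ r ∈ Finset.range s, prob G σ (t + r) (B r) := by
  induction s with
  | zero => simp [killed]
  | succ s ih =>
    rw [Finset.sum_range_succ]
    have h1 : ∑ τ, (law G σ (t + (s + 1)) τ - killed (law G σ t) B (s + 1) τ) =
        ∑ ρ, (law G σ (t + s) ρ - if ρ ∈ B s then 0 else killed (law G σ t) B s ρ) := by
      have : ∀ τ, law G σ (t + (s + 1)) τ - killed (law G σ t) B (s + 1) τ =
          ∑ ρ, (law G σ (t + s) ρ - if ρ ∈ B s then 0 else killed (law G σ t) B s ρ) *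
            step G ρ τ := by
        intro τ
        simp only [sub_mul, Finset.sum_sub_distrib]
        rfl
      simp only [this]
      rw [Finset.sum_comm]
      simp only [← Finset.mul_sum, sum_step hn, mul_one]
    have h2 : ∀ ρ, (law G σ (t + s) ρ - if ρ ∈ B s then 0 else killed (law G σ t) B s ρ) ≤
        (law G σ (t + s) ρ - killed (law G σ t) B s ρ) +
          if ρ ∈ B s then law G σ (t + s) ρ else 0 := by
      intro ρ
      have := killed_le_law (B := B) σ t s ρ
      split_ifs <;> linarith
    rw [h1]
    refine (Finset.sum_le_sum fun ρ _ => h2 ρ).trans ?_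
    rw [Finset.sum_add_distrib, ← Finset.sum_filter]
    exact add_le_add ih le_rfl

theorem prob_le_killed_add (hn : 2 ≤ n) (σ : Config G n) (t s : ℕ) (A : Set (Config G n)) :
    prob G σ (t + s) A ≤
      ∑ τ ∈ Finset.univ.filter (fun τ => τ ∈ A), killed (law G σ t) B s τ +
        ∑ r ∈ Finset.range s, prob G σ (t + r) (B r) := by
  have h := sum_law_sub_killed_le (B := B) hn σ t s
  have h2 : ∑ τ ∈ Finset.univ.filter (fun τ => τ ∈ A),
      (law G σ (t + s) τ - killed (law G σ t) B s τ) ≤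
      ∑ τ, (law G σ (t + s) τ - killed (law G σ t) B s τ) :=
    Finset.sum_le_sum_of_subset_of_nonneg (Finset.filter_subset _ _)
      fun τ _ _ => sub_nonneg.2 (killed_le_law σ t s τ)
  rw [Finset.sum_sub_distrib] at h2
  unfold prob at *
  linarith

theorem prob_union_le (σ : Config G n) (t : ℕ) (A A' : Set (Config G n)) :
    prob G σ t (A ∪ A') ≤ prob G σ t A + prob G σ t A' := by
  unfold prob
  simp only [Finset.sum_filter]
  rw [← Finset.sum_add_distrib]
  refine Finset.sum_le_sum fun τ _ => ?_
  have := law_nonneg σ t τ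
  by_cases h1 : τ ∈ A <;> by_cases h2 : τ ∈ A' <;> simp [h1, h2, this]

theorem prob_le_one (hn : 2 ≤ n) (σ : Config G n) (t : ℕ) (A : Set (Config G n)) :
    prob G σ t A ≤ 1 := by
  rw [← sum_law hn σ t]
  exact Finset.sum_le_sum_of_subset_of_nonneg (Finset.filter_subset _ _)
    fun τ _ _ => law_nonneg σ t τ

end Killed

section Drift

open scoped InnerProductSpace

variable {G : Type} [Group G] {n : ℕ}
variable {E : Type} [NormedAddCommGroup E] [InnerProductSpace ℝ E]

/-- The average of `v` over the sites in `A`. -/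
def siteAvg (v : G → E) (A : Finset (Fin n)) (σ : Config G n) : E :=
  (A.card : ℝ)⁻¹ • ∑ i ∈ A, v (σ i)

theorem norm_siteAvg_sq_le {v : G → E} {Q : ℝ} (hQ : 0 ≤ Q) (hv : ∀ g, ‖v g‖ ^ 2 ≤ Q)
    (A : Finset (Fin n)) (σ : Config G n) : ‖siteAvg v A σ‖ ^ 2 ≤ Q := by
  have hv' : ∀ g, ‖v g‖ ≤ Real.sqrt Q := fun g => Real.le_sqrt_of_sq_le (hv g)
  have h : ‖siteAvg v A σ‖ ≤ Real.sqrt Q := by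
    rw [siteAvg, norm_smul, norm_inv, Real.norm_natCast]
    have h1 : ‖∑ i ∈ A, v (σ i)‖ ≤ A.card * Real.sqrt Q := by
      refine (norm_sum_le_of_le A fun i _ => hv' (σ i)).trans ?_
      simp
    rcases A.card.eq_zero_or_pos with h0 | h0
    · simp [h0]
    · rw [inv_mul_le_iff₀ (by exact_mod_cast h0)]
      exact h1
  calc ‖siteAvg v A σ‖ ^ 2 ≤ Real.sqrt Q ^ 2 := by gcongr
    _ = Q := Real.sq_sqrt hQ

theorem siteAvg_applyMove (v : G → E) (A : Finset (Fin n)) (σ : Config G n) (m : Move n) :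
    siteAvg v A (applyMove G σ m) = siteAvg v A σ +
      if m.1.1.1 ∈ A then (A.card : ℝ)⁻¹ •
        (v (σ m.1.1.1 * (if m.2 then σ m.1.1.2 else (σ m.1.1.2)⁻¹)) - v (σ m.1.1.1)) else 0 := by
  by_cases hi : m.1.1.1 ∈ A
  · rw [if_pos hi, siteAvg, siteAvg, ← smul_add, ← Finset.add_sum_erase A _ hi, ← Finset.add_sum_erase A _ hi]
    congr 1
    have : ∀ i ∈ A.erase m.1.1.1, v (applyMove G σ m i) = v (σ i) := by
      intro i h
      rw [applyMove, Function.update_of_ne (Finset.ne_of_mem_erase h)]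
    rw [Finset.sum_congr rfl this]
    simp only [applyMove, Function.update_self]
    abel
  · rw [if_neg hi, add_zero, siteAvg, siteAvg]
    congr 1
    refine Finset.sum_congr rfl fun i h => ?_
    rw [applyMove, Function.update_of_ne]
    rintro rfl
    exact hi h

theorem sum_move (f : Fin n → Fin n → Bool → ℝ) :
    ∑ m : Move n, f m.1.1.1 m.1.1.2 m.2 =
      ∑ i, ∑ j, ∑ b, f i j b - ∑ i, ∑ b, f i i b := by
  rw [Fintype.sum_prod_type]
  rw [← Finset.sum_subtype (p := fun p : Fin n × Fin n => p.1 ≠ p.2)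
    (Finset.univ.filter fun p : Fin n × Fin n => p.1 ≠ p.2) (by simp)
    (fun p => ∑ b, f p.1 p.2 b), eq_sub_iff_add_eq]
  have h2 : ∑ i, ∑ b, f i i b =
      ∑ p ∈ Finset.univ.filter (fun p : Fin n × Fin n => ¬ p.1 ≠ p.2), ∑ b, f p.1 p.2 b := by
    rw [Finset.sum_filter, Fintype.sum_prod_type]
    refine Finset.sum_congr rfl fun i _ => ?_
    simp
  rw [h2, Finset.sum_filter_add_sum_filter_not, Fintype.sum_prod_type]

variable {v : G → E} {R : G → E →ₗ[ℝ] E} {Q : ℝ} {A : Finset (Fin n)}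

theorem sum_inner_increment_le (hR : ∀ g h, v (g * h) = R h (v g))
    (hinv : ∀ h w, ⟪w, R h⁻¹ w⟫_ℝ = ⟪w, R h w⟫_ℝ) (hQ : 0 ≤ Q) (hv : ∀ g, ‖v g‖ ^ 2 ≤ Q)
    (hA : 0 < A.card) (σ : Config G n) {h : ℝ}
    (hX : ∑ j, ⟪siteAvg v A σ, R (σ j) (siteAvg v A σ)⟫_ℝ ≤ n * h * ‖siteAvg v A σ‖ ^ 2) :
    ∑ m : Move n, ⟪siteAvg v A σ, siteAvg v A (applyMove G σ m) - siteAvg v A σ⟫_ℝ ≤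
      -(2 * n * (1 - h) * ‖siteAvg v A σ‖ ^ 2) + 4 * Q := by
  set y := siteAvg v A σ with hy
  have hk : (0 : ℝ) < A.card := by exact_mod_cast hA
  set f : Fin n → Fin n → Bool → ℝ := fun i j b => if i ∈ A then
    (A.card : ℝ)⁻¹ * (⟪y, R (if b then σ j else (σ j)⁻¹) (v (σ i))⟫_ℝ - ⟪y, v (σ i)⟫_ℝ) else 0
    with hf
  have h1 : ∀ m : Move n, ⟪y, siteAvg v A (applyMove G σ m) - y⟫_ℝ = f m.1.1.1 m.1.1.2 m.2 := by
    intro m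
    rw [siteAvg_applyMove, ← hy, add_sub_cancel_left]
    simp only [hf]
    by_cases hi : m.1.1.1 ∈ A
    · simp only [if_pos hi, inner_smul_right, inner_sub_right, hR]
    · simp only [if_neg hi, inner_zero_right]
  have h2 : ∀ (j : Fin n) (b : Bool), ∑ i, f i j b =
      ⟪y, R (if b then σ j else (σ j)⁻¹) y⟫_ℝ - ‖y‖ ^ 2 := by
    intro j b
    simp only [hf]
    rw [← Finset.sum_filter, Finset.filter_mem_eq_inter, Finset.univ_inter, ← Finset.mul_sum,
      Finset.sum_sub_distrib, ← inner_sum, ← inner_sum, ← map_sum, mul_sub,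
      ← inner_smul_right, ← inner_smul_right, ← map_smul, ← real_inner_self_eq_norm_sq]
    rfl
  have h3 : ∑ i, ∑ j, ∑ b, f i j b ≤ -(2 * n * (1 - h) * ‖y‖ ^ 2) := by
    rw [Finset.sum_comm]
    have : ∀ j, ∑ i, ∑ b, f i j b = 2 * ⟪y, R (σ j) y⟫_ℝ - 2 * ‖y‖ ^ 2 := by
      intro j
      rw [Finset.sum_comm, Fintype.sum_bool, h2, h2]
      simp only [if_true, Bool.false_eq_true, if_false, hinv]
      ring
    simp only [this]
    rw [Finset.sum_sub_distrib, ← Finset.mul_sum, Finset.sum_const, Finset.card_univ,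
      Fintype.card_fin, nsmul_eq_mul]
    linarith
  have hin : ∀ g, |⟪y, v g⟫_ℝ| ≤ Q := by
    intro g
    refine (abs_real_inner_le_norm _ _).trans ?_
    have := norm_siteAvg_sq_le hQ hv A σ
    rw [← hy] at this
    nlinarith [hv g, sq_nonneg (‖y‖ - ‖v g‖)]
  have h4 : -(4 * Q) ≤ ∑ i, ∑ b, f i i b := by
    have : ∀ i, (if i ∈ A then -((A.card : ℝ)⁻¹ * (4 * Q)) else 0) ≤ ∑ b, f i i b := by
      intro i
      rw [Fintype.sum_bool]
      simp only [hf]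
      by_cases hi : i ∈ A
      · simp only [if_pos hi, ← hR]
        have e1 := abs_le.1 (hin (σ i * σ i))
        have e2 := abs_le.1 (hin (σ i * (σ i)⁻¹))
        have e3 := abs_le.1 (hin (σ i))
        rw [← mul_add, ← mul_neg]
        refine mul_le_mul_of_nonneg_left ?_ (by positivity)
        simp only [if_true, Bool.false_eq_true, if_false]
        linarith
      · simp [hi]
    refine le_trans ?_ (Finset.sum_le_sum fun i _ => this i)
    rw [← Finset.sum_filter, Finset.filter_mem_eq_inter, Finset.univ_inter, Finset.sum_const,
      nsmul_eq_mul, mul_neg, ← mul_assoc, mul_inv_cancel₀ hk.ne', one_mul]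
  simp only [h1]
  rw [sum_move]
  linarith

theorem norm_increment_sq_le (hQ : 0 ≤ Q) (hv : ∀ g, ‖v g‖ ^ 2 ≤ Q)
    (hA : 0 < A.card) (σ : Config G n) (m : Move n) :
    ‖siteAvg v A (applyMove G σ m) - siteAvg v A σ‖ ^ 2 ≤ 4 * Q / (A.card : ℝ) ^ 2 := by
  rw [siteAvg_applyMove, add_sub_cancel_left]
  by_cases hi : m.1.1.1 ∈ A
  · rw [if_pos hi, norm_smul, mul_pow, norm_inv, Real.norm_natCast, inv_pow, inv_mul_eq_div]
    gcongr
    have hs : ∀ x y : E, ‖x‖ ^ 2 ≤ Q → ‖y‖ ^ 2 ≤ Q → ‖x - y‖ ^ 2 ≤ 4 * Q := by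
      intro x y hx hy
      have := norm_sub_le x y
      have h0 := norm_nonneg (x - y)
      nlinarith [sq_nonneg (‖x‖ - ‖y‖)]
    exact hs _ _ (hv _) (hv _)
  · rw [if_neg hi, norm_zero, zero_pow two_ne_zero]
    positivity

end Drift

end PR

namespace PR

section ExpMoment

open scoped InnerProductSpace

theorem exp_increment_le {θ u a b e : ℝ} (hθ : 0 ≤ θ) (hu : 0 ≤ u) (hb : 0 ≤ b)
    (hab : a ^ 2 ≤ u * b) (hbe : b ≤ e) (hz : |θ * (2 * a + b)| ≤ 1) :
    Real.exp (θ * (u + 2 * a + b)) ≤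
      Real.exp (θ * u) * (1 + 2 * θ * a + θ * e + θ ^ 2 * (8 * u * e + 2 * e ^ 2)) := by
  have h1 := (abs_le.1 (Real.abs_exp_sub_one_sub_id_le hz)).2
  have h2 : (θ * (2 * a + b)) ^ 2 ≤ θ ^ 2 * (8 * u * e + 2 * e ^ 2) := by
    rw [mul_pow]
    refine mul_le_mul_of_nonneg_left ?_ (sq_nonneg θ)
    have h3 : (2 * a + b) ^ 2 ≤ 8 * a ^ 2 + 2 * b ^ 2 := by nlinarith [sq_nonneg (2 * a - b)]
    have h4 : u * b ≤ u * e := mul_le_mul_of_nonneg_left hbe hu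
    have h5 : b ^ 2 ≤ e ^ 2 := pow_le_pow_left₀ hb hbe 2
    linarith
  have h6 : θ * b ≤ θ * e := mul_le_mul_of_nonneg_left hbe hθ
  have : θ * (u + 2 * a + b) = θ * u + θ * (2 * a + b) := by ring
  rw [this, Real.exp_add]
  refine mul_le_mul_of_nonneg_left ?_ (Real.exp_pos _).le
  linarith

theorem sum_geom_exp_le {n : ℕ} (hn : 1 ≤ n) (L : ℕ) :
    ∑ j ∈ Finset.range L, Real.exp (-(1 / (4 * (n : ℝ)))) ^ j ≤ 8 * n := by
  have hn' : (1 : ℝ) ≤ n := by exact_mod_cast hn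
  set x : ℝ := 1 / (4 * (n : ℝ)) with hx
  have hx0 : 0 < x := by positivity
  have hx1 : x ≤ 1 := by
    rw [hx, div_le_one (by positivity)]
    linarith
  have hq : Real.exp (-x) ≤ 1 - x / 2 := by
    rw [Real.exp_neg, inv_le_comm₀ (Real.exp_pos x) (by linarith)]
    refine le_trans ?_ (Real.add_one_le_exp x)
    rw [inv_le_iff_one_le_mul₀ (by linarith)]
    nlinarith
  have hg := geom_sum_mul (Real.exp (-x)) L
  have hp : 0 ≤ Real.exp (-x) ^ L := by positivity
  have hS : 0 ≤ ∑ j ∈ Finset.range L, Real.exp (-x) ^ j :=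
    Finset.sum_nonneg fun j _ => by positivity
  have h1 : (∑ j ∈ Finset.range L, Real.exp (-x) ^ j) * (x / 2) ≤ 1 := by nlinarith
  have h2 : x / 2 = 1 / (8 * n) := by rw [hx]; field_simp; norm_num
  rw [h2, mul_one_div, div_le_one (by positivity)] at h1
  exact h1

theorem exponent_increment_le {n θ u e h S N Q : ℝ} (hn : 2 ≤ n) (hQ : 1 ≤ Q) (hθ0 : 0 ≤ θ)
    (hθ1 : θ ≤ n / (512 * Q ^ 3)) (hu0 : 0 ≤ u) (he0 : 0 ≤ e) (he1 : e ≤ 16 * Q ^ 3 / n ^ 2)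
    (hSN : 2 * S / N ≤ -(2 * (1 - h) / n * u) + 8 * Q / n ^ 2) :
    2 * θ * (S / N) + θ * e + θ ^ 2 * (8 * u * e + 2 * e ^ 2) ≤
      θ * (- 2 * (1 - h) / n + 128 * Q ^ 3 * θ / n ^ 2) * u + 25 * Q ^ 3 * θ / n ^ 2 := by
  have hQ0 : 0 < Q := by linarith
  have hn0 : 0 < n := by linarith
  have h1 : 2 * θ * (S / N) ≤ θ * (-(2 * (1 - h) / n * u) + 8 * Q / n ^ 2) := by
    rw [show 2 * θ * (S / N) = θ * (2 * S / N) by ring]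
    gcongr
  have h2 : θ * e ≤ θ * (16 * Q ^ 3 / n ^ 2) := by gcongr
  have h3 : θ ^ 2 * (8 * u * e) ≤ θ ^ 2 * (8 * u * (16 * Q ^ 3 / n ^ 2)) := by gcongr
  have h4 : θ ^ 2 * (2 * e ^ 2) ≤ Q ^ 3 * θ / n ^ 2 := by
    calc θ ^ 2 * (2 * e ^ 2) = θ * (θ * (2 * e ^ 2)) := by ring
      _ ≤ θ * (n / (512 * Q ^ 3) * (2 * (16 * Q ^ 3 / n ^ 2) ^ 2)) := by gcongr
      _ = Q ^ 3 * θ / n ^ 2 * (1 / n) := by field_simp; ring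
      _ ≤ Q ^ 3 * θ / n ^ 2 * 1 := by
          gcongr
          rw [div_le_one (by linarith)]
          linarith
      _ = _ := by ring
  have h5 : θ * (8 * Q / n ^ 2) ≤ 8 * Q ^ 3 * θ / n ^ 2 := by
    rw [show 8 * Q ^ 3 * θ / n ^ 2 = θ * (8 * Q ^ 3 / n ^ 2) by ring]
    gcongr
    exact le_self_pow₀ hQ (by norm_num)
  have e1 : θ * (16 * Q ^ 3 / n ^ 2) = 16 * (Q ^ 3 * θ / n ^ 2) := by ring
  have e2 : θ ^ 2 * (8 * u * (16 * Q ^ 3 / n ^ 2)) = θ * (128 * Q ^ 3 * θ / n ^ 2) * u := by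
    ring
  have e3 : 8 * Q ^ 3 * θ / n ^ 2 = 8 * (Q ^ 3 * θ / n ^ 2) := by ring
  have e4 : 25 * Q ^ 3 * θ / n ^ 2 = 25 * (Q ^ 3 * θ / n ^ 2) := by ring
  have e5 : θ * (- 2 * (1 - h) / n + 128 * Q ^ 3 * θ / n ^ 2) * u =
    θ * (-(2 * (1 - h) / n * u)) + θ * (128 * Q ^ 3 * θ / n ^ 2) * u := by ring
  rw [e5, e4]
  rw [e3] at h5
  rw [e1] at h2
  rw [e2] at h3
  linarith

variable {G : Type} [Group G] [Fintype G] {n : ℕ}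
variable {E : Type} [NormedAddCommGroup E] [InnerProductSpace ℝ E]
variable {v : G → E} {R : G → E →ₗ[ℝ] E} {Q : ℝ} {A : Finset (Fin n)}

theorem sum_step_mul_exp_le (hn : 2 ≤ n) (hR : ∀ g h, v (g * h) = R h (v g))
    (hinv : ∀ h w, ⟪w, R h⁻¹ w⟫_ℝ = ⟪w, R h w⟫_ℝ) (hQ : 1 ≤ Q) (hv : ∀ g, ‖v g‖ ^ 2 ≤ Q)
    (hA : (n : ℝ) ≤ 2 * Q * A.card) (σ : Config G n) {h θ : ℝ} (hθ0 : 0 ≤ θ)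
    (hθ1 : θ ≤ n / (512 * Q ^ 3)) (hh : h ≤ 1)
    (hX : ∑ j, ⟪siteAvg v A σ, R (σ j) (siteAvg v A σ)⟫_ℝ ≤ n * h * ‖siteAvg v A σ‖ ^ 2) :
    ∑ σ', step G σ σ' * Real.exp (θ * ‖siteAvg v A σ'‖ ^ 2) ≤
      Real.exp (θ * (1 - 2 * (1 - h) / n + 128 * Q ^ 3 * θ / n ^ 2) * ‖siteAvg v A σ‖ ^ 2 +
        25 * Q ^ 3 * θ / n ^ 2) := by
  have hn' : (2 : ℝ) ≤ n := by exact_mod_cast hn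
  have hQ0 : 0 ≤ Q := by linarith
  have hk : (0 : ℝ) < A.card := by
    by_contra hc
    have : (A.card : ℝ) = 0 := le_antisymm (not_lt.1 hc) (Nat.cast_nonneg _)
    rw [this] at hA
    linarith
  have hA0 : 0 < A.card := by exact_mod_cast hk
  have hk1 : (1 : ℝ) ≤ A.card := by exact_mod_cast hA0
  set k : ℝ := (A.card : ℝ) with hkdef
  set y := siteAvg v A σ with hy
  set u := ‖y‖ ^ 2 with hu
  set e : ℝ := 4 * Q / k ^ 2 with he
  have hu0 : 0 ≤ u := sq_nonneg _
  have he0 : 0 ≤ e := by positivity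
  have huQ : u ≤ Q := norm_siteAvg_sq_le hQ0 hv A σ
  set Δ : Move n → E := fun m => siteAvg v A (applyMove G σ m) - y with hΔ
  have hΔe : ∀ m, ‖Δ m‖ ^ 2 ≤ e := norm_increment_sq_le hQ0 hv hA0 σ
  have hab : ∀ m, ⟪y, Δ m⟫_ℝ ^ 2 ≤ u * ‖Δ m‖ ^ 2 := by
    intro m
    rw [hu, ← mul_pow, ← sq_abs]
    exact pow_le_pow_left₀ (abs_nonneg _) (abs_real_inner_le_norm _ _) 2
  have hθk : θ * (8 * Q / k) ≤ 1 := by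
    have h1 : 8 * Q / k ≤ 16 * Q ^ 2 / n := by
      rw [div_le_div_iff₀ hk (by linarith)]
      nlinarith
    calc θ * (8 * Q / k) ≤ n / (512 * Q ^ 3) * (16 * Q ^ 2 / n) := by gcongr
      _ = 1 / (32 * Q) := by field_simp; norm_num
      _ ≤ 1 := by rw [div_le_one (by linarith)]; linarith
  have hz : ∀ m, |θ * (2 * ⟪y, Δ m⟫_ℝ + ‖Δ m‖ ^ 2)| ≤ 1 := by
    intro m
    have h1 : |⟪y, Δ m⟫_ℝ| ≤ 2 * Q / k := by
      refine abs_le_of_sq_le_sq ?_ (by positivity)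
      calc ⟪y, Δ m⟫_ℝ ^ 2 ≤ u * ‖Δ m‖ ^ 2 := hab m
        _ ≤ Q * e := mul_le_mul huQ (hΔe m) (sq_nonneg _) hQ0
        _ = (2 * Q / k) ^ 2 := by rw [he]; ring
    have h2 : ‖Δ m‖ ^ 2 ≤ 4 * Q / k := by
      refine (hΔe m).trans ?_
      rw [he]
      gcongr
      nlinarith
    have h3 : |2 * ⟪y, Δ m⟫_ℝ + ‖Δ m‖ ^ 2| ≤ 8 * Q / k := by
      rw [abs_le] at h1 ⊢
      have h4 : 8 * Q / k = 2 * (2 * Q / k) + 4 * Q / k := by ring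
      rw [h4]
      constructor <;> nlinarith [sq_nonneg ‖Δ m‖, h1.1, h1.2]
    rw [abs_mul, abs_of_nonneg hθ0]
    exact (mul_le_mul_of_nonneg_left h3 hθ0).trans hθk
  have hm : ∀ m : Move n, Real.exp (θ * ‖siteAvg v A (applyMove G σ m)‖ ^ 2) ≤
      Real.exp (θ * u) *
        (1 + 2 * θ * ⟪y, Δ m⟫_ℝ + θ * e + θ ^ 2 * (8 * u * e + 2 * e ^ 2)) := by
    intro m
    have : siteAvg v A (applyMove G σ m) = y + Δ m := (add_sub_cancel _ _).symm
    rw [this, norm_add_sq_real]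
    exact exp_increment_le hθ0 hu0 (sq_nonneg _) (hab m) (hΔe m) (hz m)
  have hN := card_move_pos hn
  have hNc := card_move_cast hn
  set N : ℝ := (Fintype.card (Move n) : ℝ) with hNdef
  have hS : ∑ m : Move n, ⟪y, Δ m⟫_ℝ ≤ -(2 * n * (1 - h) * u) + 4 * Q :=
    sum_inner_increment_le hR hinv hQ0 hv hA0 σ hX
  set S := ∑ m : Move n, ⟪y, Δ m⟫_ℝ with hSdef
  have hSN : 2 * S / N ≤ -(2 * (1 - h) / n * u) + 8 * Q / n ^ 2 := by
    have h1 : 2 * S / N ≤ -(2 * (1 - h) * u) / (n - 1) + 4 * Q / (n * (n - 1)) := by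
      rw [hNc]
      calc 2 * S / (2 * n * (n - 1)) ≤
          2 * (-(2 * n * (1 - h) * u) + 4 * Q) / (2 * n * (n - 1)) := by
            have : (0 : ℝ) < n - 1 := by linarith
            gcongr
        _ = _ := by
            have : (n : ℝ) - 1 ≠ 0 := by linarith
            field_simp
    have h2 : -(2 * (1 - h) * u) / ((n : ℝ) - 1) ≤ -(2 * (1 - h) / n * u) := by
      have h3 : 0 ≤ 2 * (1 - h) * u := mul_nonneg (by linarith) hu0
      have h4 : 2 * (1 - h) / n * u = 2 * (1 - h) * u / n := by ring
      rw [h4, neg_div, neg_le_neg_iff]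
      exact div_le_div_of_nonneg_left h3 (by linarith) (by linarith)
    have h5 : 4 * Q / ((n : ℝ) * (n - 1)) ≤ 8 * Q / n ^ 2 := by
      rw [div_le_div_iff₀ (by nlinarith) (by positivity)]
      have : 0 ≤ 4 * Q * n * ((n : ℝ) - 2) :=
        mul_nonneg (by positivity) (by linarith)
      nlinarith
    linarith
  have he1 : e ≤ 16 * Q ^ 3 / n ^ 2 := by
    rw [he, div_le_div_iff₀ (by positivity) (by positivity)]
    have : (n : ℝ) ^ 2 ≤ (2 * Q * k) ^ 2 := pow_le_pow_left₀ (by positivity) hA 2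
    nlinarith
  have hfin := exponent_increment_le hn' hQ hθ0 hθ1 hu0 he0 he1 hSN
  rw [sum_step_mul, ← hNdef]
  calc (∑ m : Move n, Real.exp (θ * ‖siteAvg v A (applyMove G σ m)‖ ^ 2)) / N
      ≤ (∑ m : Move n, Real.exp (θ * u) *
        (1 + 2 * θ * ⟪y, Δ m⟫_ℝ + θ * e + θ ^ 2 * (8 * u * e + 2 * e ^ 2))) / N := by
        gcongr with m
        exact hm m
    _ = Real.exp (θ * u) *
        (1 + (2 * θ * (S / N) + θ * e + θ ^ 2 * (8 * u * e + 2 * e ^ 2))) := by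
        rw [← Finset.mul_sum]
        simp only [add_assoc, Finset.sum_add_distrib, Finset.sum_const, Finset.card_univ,
          nsmul_eq_mul, ← Finset.mul_sum]
        rw [← hSdef, ← hNdef]
        field_simp
    _ ≤ Real.exp (θ * u) * Real.exp (θ * (- 2 * (1 - h) / n + 128 * Q ^ 3 * θ / n ^ 2) * u +
          25 * Q ^ 3 * θ / n ^ 2) := by
        gcongr
        rw [add_comm]
        exact (add_le_add_left hfin 1).trans (Real.add_one_le_exp _)
    _ = _ := by
        rw [← Real.exp_add]
        congr 1
        ring

variable {w : Config G n → ℝ} {B : ℕ → Set (Config G n)}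

theorem sum_killed_mul_exp_le (hn : 2 ≤ n) (hR : ∀ g h, v (g * h) = R h (v g))
    (hinv : ∀ h w, ⟪w, R h⁻¹ w⟫_ℝ = ⟪w, R h w⟫_ℝ) (hQ : 1 ≤ Q) (hv : ∀ g, ‖v g‖ ^ 2 ≤ Q)
    (hA : (n : ℝ) ≤ 2 * Q * A.card) (hw : ∀ τ, 0 ≤ w τ) {h θ : ℕ → ℝ} (hθ0 : ∀ s, 0 ≤ θ s)
    (L : ℕ) (hθ1 : ∀ s ≤ L, θ s ≤ n / (512 * Q ^ 3)) (hh : ∀ s, h s ≤ 1)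
    (hX : ∀ s, ∀ σ ∉ B s, ∑ j, ⟪siteAvg v A σ, R (σ j) (siteAvg v A σ)⟫_ℝ ≤
      n * h s * ‖siteAvg v A σ‖ ^ 2)
    (hrec : ∀ s < L, θ (s + 1) * (1 - 2 * (1 - h s) / n + 128 * Q ^ 3 * θ (s + 1) / n ^ 2) ≤ θ s) :
    ∑ τ, killed w B L τ * Real.exp (θ L * ‖siteAvg v A τ‖ ^ 2) ≤
      Real.exp (25 * Q ^ 3 / n ^ 2 * ∑ s ∈ Finset.range L, θ (s + 1)) *
        ∑ τ, w τ * Real.exp (θ 0 * ‖siteAvg v A τ‖ ^ 2) := by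
  induction L with
  | zero => simp [killed]
  | succ L ih =>
    have ih' := ih (fun s hs => hθ1 s (by omega)) (fun s hs => hrec s (by omega))
    have hstep : ∑ τ, killed w B (L + 1) τ * Real.exp (θ (L + 1) * ‖siteAvg v A τ‖ ^ 2) ≤
        Real.exp (25 * Q ^ 3 / n ^ 2 * θ (L + 1)) *
          ∑ τ, killed w B L τ * Real.exp (θ L * ‖siteAvg v A τ‖ ^ 2) := by
      simp only [killed, Finset.sum_mul]
      rw [Finset.sum_comm, Finset.mul_sum]
      refine Finset.sum_le_sum fun ρ _ => ?_
      simp only [mul_assoc, ← Finset.mul_sum]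
      have hk := killed_nonneg (B := B) hw L ρ
      by_cases hρ : ρ ∈ B L
      · rw [if_pos hρ, zero_mul]
        positivity
      · rw [if_neg hρ, mul_left_comm]
        refine mul_le_mul_of_nonneg_left ?_ hk
        refine (sum_step_mul_exp_le hn hR hinv hQ hv hA ρ (hθ0 _) (hθ1 _ le_rfl) (hh L)
          (hX L ρ hρ)).trans ?_
        rw [← Real.exp_add, add_comm]
        refine Real.exp_le_exp.2 (add_le_add (le_of_eq (by ring)) ?_)
        exact mul_le_mul_of_nonneg_right (hrec L (Nat.lt_succ_self L)) (sq_nonneg _)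
    refine hstep.trans ?_
    rw [Finset.sum_range_succ, mul_add,
      add_comm (25 * Q ^ 3 / (n : ℝ) ^ 2 * ∑ s ∈ Finset.range L, θ (s + 1)),
      Real.exp_add, mul_assoc]
    exact mul_le_mul_of_nonneg_left ih' (Real.exp_pos _).le

/-- Exponential moment bound for the killed chain, where `h s` bounds the expansion rate of
the drift at time `s`. -/
theorem sum_killed_mul_exp_le_of_sum_le (hn : 2 ≤ n) (hR : ∀ g h, v (g * h) = R h (v g))
    (hinv : ∀ h w, ⟪w, R h⁻¹ w⟫_ℝ = ⟪w, R h w⟫_ℝ) (hQ : 1 ≤ Q) (hv : ∀ g, ‖v g‖ ^ 2 ≤ Q)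
    (hA : (n : ℝ) ≤ 2 * Q * A.card) (hw : ∀ τ, 0 ≤ w τ) {h : ℕ → ℝ}
    (hh : ∀ s, h s ≤ 3 / 4)
    (hX : ∀ s, ∀ σ ∉ B s, ∑ j, ⟪siteAvg v A σ, R (σ j) (siteAvg v A σ)⟫_ℝ ≤
      n * h s * ‖siteAvg v A σ‖ ^ 2)
    (L : ℕ) {H : ℝ} (hH : ∑ s ∈ Finset.range L, h s ≤ n * H) :
    ∑ τ, killed w B L τ * Real.exp (n / (512 * Q ^ 3) * ‖siteAvg v A τ‖ ^ 2) ≤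
      Real.exp 1 * ∑ τ, w τ * Real.exp (n / (512 * Q ^ 3) *
        Real.exp (-(2 * L / n) + 2 * H + 2) * ‖siteAvg v A τ‖ ^ 2) := by
  have hn' : (2 : ℝ) ≤ n := by exact_mod_cast hn
  have hn0 : (0 : ℝ) < n := by linarith
  have hQ0 : 0 < Q := by linarith
  set q : ℝ := Real.exp (-(1 / (4 * (n : ℝ)))) with hq
  have hq0 : 0 < q := Real.exp_pos _
  have hq1 : q ≤ 1 := by
    rw [hq, Real.exp_le_one_iff, neg_nonpos]
    positivity
  set γ : ℕ → ℝ := fun r => 2 * (1 - h r) / n - q ^ (L - 1 - r) / (4 * n) with hγ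
  have hγ1 : ∀ r, 1 / (4 * n) ≤ γ r := by
    intro r
    have h1 : q ^ (L - 1 - r) ≤ 1 := pow_le_one₀ hq0.le hq1
    have h2 := hh r
    rw [hγ]
    have h3 : 2 * (1 - h r) / n - q ^ (L - 1 - r) / (4 * n) =
      (8 * (1 - h r) - q ^ (L - 1 - r)) / (4 * n) := by
      field_simp
      ring
    simp only [h3]
    gcongr
    linarith
  set θ : ℕ → ℝ := fun s => n / (512 * Q ^ 3) * Real.exp (-∑ r ∈ Finset.Ico s L, γ r) with hθ
  have hθ0 : ∀ s, 0 ≤ θ s := fun s => by simp only [hθ]; positivity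
  have hθq : ∀ s, θ s ≤ n / (512 * Q ^ 3) * q ^ (L - s) := by
    intro s
    simp only [hθ]
    gcongr
    rw [hq, ← Real.exp_nat_mul]
    refine Real.exp_le_exp.2 ?_
    have : ∑ r ∈ Finset.Ico s L, 1 / (4 * (n : ℝ)) ≤ ∑ r ∈ Finset.Ico s L, γ r :=
      Finset.sum_le_sum fun r _ => hγ1 r
    rw [Finset.sum_const, Nat.card_Ico, nsmul_eq_mul] at this
    linarith
  have hθ1 : ∀ s ≤ L, θ s ≤ n / (512 * Q ^ 3) := fun s _ =>
    (hθq s).trans (mul_le_of_le_one_right (by positivity) (pow_le_one₀ hq0.le hq1))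
  have hrec : ∀ s < L,
      θ (s + 1) * (1 - 2 * (1 - h s) / n + 128 * Q ^ 3 * θ (s + 1) / n ^ 2) ≤ θ s := by
    intro s hs
    have h1 : 128 * Q ^ 3 * θ (s + 1) / n ^ 2 ≤ q ^ (L - 1 - s) / (4 * n) := by
      calc 128 * Q ^ 3 * θ (s + 1) / n ^ 2
          ≤ 128 * Q ^ 3 * (n / (512 * Q ^ 3) * q ^ (L - (s + 1))) / n ^ 2 := by
            gcongr
            exact hθq _
        _ = q ^ (L - 1 - s) / (4 * n) := by
            rw [show L - (s + 1) = L - 1 - s by omega]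
            field_simp
            norm_num
    have h2 : θ s = θ (s + 1) * Real.exp (-γ s) := by
      simp only [hθ]
      rw [Finset.sum_eq_sum_Ico_succ_bot hs, neg_add, Real.exp_add]
      ring
    rw [h2]
    refine mul_le_mul_of_nonneg_left ?_ (hθ0 _)
    refine le_trans ?_ (Real.add_one_le_exp _)
    simp only [hγ]
    linarith
  have hgeom := sum_geom_exp_le (show 1 ≤ n by omega) L
  rw [← hq, ← Finset.sum_range_reflect] at hgeom
  have main := sum_killed_mul_exp_le hn hR hinv hQ hv hA hw hθ0 L hθ1
    (fun s => (hh s).trans (by norm_num)) hX hrec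
  have hL : θ L = n / (512 * Q ^ 3) := by simp [hθ]
  rw [hL] at main
  refine main.trans ?_
  have hadd : 25 * Q ^ 3 / n ^ 2 * ∑ s ∈ Finset.range L, θ (s + 1) ≤ 1 := by
    have h1 : ∑ s ∈ Finset.range L, θ (s + 1) ≤ n / (512 * Q ^ 3) * (8 * n) := by
      refine (Finset.sum_le_sum fun s _ => hθq (s + 1)).trans ?_
      rw [← Finset.mul_sum]
      gcongr
      refine le_trans (le_of_eq ?_) hgeom
      refine Finset.sum_congr rfl fun s _ => ?_
      congr 1
      omega
    calc 25 * Q ^ 3 / n ^ 2 * ∑ s ∈ Finset.range L, θ (s + 1)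
        ≤ 25 * Q ^ 3 / n ^ 2 * (n / (512 * Q ^ 3) * (8 * n)) := by gcongr
      _ = 200 / 512 := by field_simp; norm_num
      _ ≤ 1 := by norm_num
  have h0 : θ 0 ≤ n / (512 * Q ^ 3) * Real.exp (-(2 * L / n) + 2 * H + 2) := by
    simp only [hθ]
    gcongr
    rw [Nat.Ico_zero_eq_range]
    simp only [hγ, Finset.sum_sub_distrib, ← Finset.sum_div, ← Finset.mul_sum, Finset.sum_const,
      Finset.card_range, nsmul_eq_mul, mul_one]
    have h1 : (∑ r ∈ Finset.range L, q ^ (L - 1 - r)) / (4 * n) ≤ 2 := by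
      rw [div_le_iff₀ (by positivity)]
      linarith
    have h2 : 2 * (L - ∑ s ∈ Finset.range L, h s) / n ≥ 2 * (L - n * H) / n := by gcongr
    have h3 : 2 * (L - n * H) / n = 2 * L / n - 2 * H := by field_simp
    linarith
  have hw0 : 0 ≤ ∑ τ, w τ * Real.exp (θ 0 * ‖siteAvg v A τ‖ ^ 2) :=
    Finset.sum_nonneg fun τ _ => mul_nonneg (hw τ) (Real.exp_pos _).le
  gcongr
  exact hw _

end ExpMoment

end PR

namespace PR

section Typical

variable {G : Type} [Group G] [Fintype G] {n : ℕ}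

theorem sum_nCount_smul {M : Type} [AddCommGroup M] [Module ℝ M] (σ : Config G n) (g : G → M) :
    ∑ a, (nCount G σ a : ℝ) • g a = ∑ i, g (σ i) := by
  rw [← Finset.sum_fiberwise_of_maps_to (s := Finset.univ) (t := Finset.univ) (g := σ)
    (fun _ _ => Finset.mem_univ _)]
  refine Finset.sum_congr rfl fun a _ => ?_
  rw [nCount, Finset.sum_congr rfl (g := fun _ => g a), Finset.sum_const, Nat.cast_smul_eq_nsmul]
  intro i hi
  rw [(Finset.mem_filter.1 hi).2]

theorem sum_nCount (σ : Config G n) : ∑ a, (nCount G σ a : ℝ) = n := by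
  have := sum_nCount_smul σ (fun _ => (1 : ℝ))
  simpa using this

theorem nCount_comp_perm (σ : Config G n) (π : Equiv.Perm (Fin n)) (a : G) :
    nCount G (σ ∘ π) a = nCount G σ a :=
  Finset.card_equiv π fun i => by simp

theorem prob_comp_perm (σ : Config G n) (π : Equiv.Perm (Fin n)) (t : ℕ) {B : Set (Config G n)}
    (hB : ∀ τ, τ ∘ π ∈ B ↔ τ ∈ B) : prob G (σ ∘ π) t B = prob G σ t B := by
  unfold prob
  rw [Finset.sum_filter, Finset.sum_filter, ← (π.symm.arrowCongr (Equiv.refl G)).sum_comp]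
  refine Finset.sum_congr rfl fun ρ _ => ?_
  have : (π.symm.arrowCongr (Equiv.refl G)) ρ = ρ ∘ π := by
    funext l; simp [Equiv.arrowCongr]
  rw [this, law_comp_perm]
  simp only [hB]

/-- The configurations obtained from `σ` by relabelling sites. -/
def orbit (σ : Config G n) : Finset (Config G n) :=
  Finset.univ.image fun π : Equiv.Perm (Fin n) => σ ∘ π

theorem card_orbit_mul_prob_le (hn : 2 ≤ n) (σ : Config G n) (t : ℕ) {B : Set (Config G n)}
    (hB : ∀ (π : Equiv.Perm (Fin n)) τ, τ ∘ π ∈ B ↔ τ ∈ B) :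
    ((orbit σ).card : ℝ) * prob G σ t B ≤ (Finset.univ.filter fun τ => τ ∈ B).card := by
  calc ((orbit σ).card : ℝ) * prob G σ t B = ∑ τ ∈ orbit σ, prob G τ t B := by
        rw [← nsmul_eq_mul, ← Finset.sum_const]
        refine Finset.sum_congr rfl fun τ hτ => ?_
        obtain ⟨π, -, rfl⟩ := Finset.mem_image.1 hτ
        exact (prob_comp_perm σ π t (hB π)).symm
    _ ≤ ∑ τ, prob G τ t B := Finset.sum_le_sum_of_subset_of_nonneg (Finset.subset_univ _)
        fun τ _ _ => Finset.sum_nonneg fun ρ _ => law_nonneg τ t ρ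
    _ = _ := by
        unfold prob
        rw [Finset.sum_comm]
        simp [sum_law_start hn]

theorem factorial_le_prod_mul_card_orbit (σ : Config G n) :
    n.factorial ≤ (∏ a, (nCount G σ a).factorial) * (orbit σ).card := by
  have h := Finset.card_le_mul_card_image (s := (Finset.univ : Finset (Equiv.Perm (Fin n))))
    (f := fun π : Equiv.Perm (Fin n) => σ ∘ ⇑π) (∏ a, (nCount G σ a).factorial) ?_
  · rw [Finset.card_univ, Fintype.card_perm, Fintype.card_fin] at h
    exact h
  · intro τ hτ
    obtain ⟨π₀, -, rfl⟩ := Finset.mem_image.1 hτ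
    have hs := DomMulAct.stabilizer_card σ
    have hc : ∀ a, Fintype.card {i // σ i = a} = nCount G σ a := fun a =>
      Fintype.card_subtype _
    simp only [hc] at hs
    rw [← hs, Fintype.card_subtype]
    refine Finset.card_le_card_of_injOn (fun π => π * π₀⁻¹) ?_ ?_
    · intro π hπ
      have hπ' : σ ∘ π = σ ∘ π₀ := (Finset.mem_filter.1 hπ).2
      simp only [Finset.coe_filter, Finset.mem_univ, true_and, Set.mem_ofPred_eq]
      funext i
      have := congrFun hπ' (π₀⁻¹ i)
      simpa using this
    · intro π _ π' _ h
      simpa using h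

theorem factorial_le_mul_pow {m n : ℕ} (hm : m ≤ n) (hn : 1 ≤ n) :
    (m.factorial : ℝ) ≤ Real.exp 1 * n * (m / Real.exp 1) ^ m := by
  have hn' : (1 : ℝ) ≤ n := by exact_mod_cast hn
  have he : (1 : ℝ) ≤ Real.exp 1 := Real.one_le_exp (by norm_num)
  rcases m with _ | m
  · simp only [Nat.factorial_zero, Nat.cast_one, pow_zero, mul_one]
    nlinarith
  have h := Stirling.stirlingSeq'_antitone (Nat.zero_le m)
  simp only [Function.comp, Nat.succ_eq_add_one, zero_add, Stirling.stirlingSeq_one] at h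
  rw [Stirling.stirlingSeq, div_le_iff₀ (by positivity)] at h
  refine h.trans ?_
  rw [← mul_assoc]
  refine mul_le_mul_of_nonneg_right ?_ (by positivity)
  rw [Real.sqrt_mul (by norm_num)]
  have h2 : Real.exp 1 / √2 * (√2 * √((m + 1 : ℕ) : ℝ)) = Real.exp 1 * √((m + 1 : ℕ) : ℝ) := by
    field_simp
  rw [h2]
  gcongr
  rw [Real.sqrt_le_iff]
  have h3 : ((m + 1 : ℕ) : ℝ) ≤ n := by exact_mod_cast hm
  exact ⟨by positivity, by nlinarith⟩

theorem pow_div_exp_le_factorial (n : ℕ) : ((n : ℝ) / Real.exp 1) ^ n ≤ n.factorial := by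
  have h := Real.pow_div_factorial_le_exp (n : ℝ) (Nat.cast_nonneg n) n
  rw [div_le_iff₀ (by positivity)] at h
  rw [div_pow, ← Real.exp_nat_mul, mul_one, div_le_iff₀ (Real.exp_pos _)]
  linarith

theorem prod_factorial_nCount_le (hn : 1 ≤ n) (σ : Config G n)
    (hσ : ∑ a, ((nCount G σ a : ℝ) / n - 1 / (Fintype.card G : ℝ)) ^ 2 ≤
      1 / (16 * (Fintype.card G : ℝ))) :
    ((∏ a, (nCount G σ a).factorial : ℕ) : ℝ) * (Fintype.card G : ℝ) ^ n ≤
      (Real.exp 1 * n) ^ Fintype.card G * (n / Real.exp 1) ^ n * Real.exp (n / 16) := by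
  have hn0 : (0 : ℝ) < n := by exact_mod_cast hn
  have hQ : (0 : ℝ) < Fintype.card G := by exact_mod_cast Fintype.card_pos
  set Q : ℝ := (Fintype.card G : ℝ) with hQd
  have hsum := sum_nCount σ
  have hsumN : ∑ a, nCount G σ a = n := by exact_mod_cast hsum
  have hle : ∀ a, nCount G σ a ≤ n := fun a =>
    (Finset.single_le_sum (f := fun a => nCount G σ a) (fun _ _ => Nat.zero_le _)
      (Finset.mem_univ a)).trans_eq hsumN
  have h1 : ((∏ a, (nCount G σ a).factorial : ℕ) : ℝ) ≤
      (Real.exp 1 * n) ^ Fintype.card G *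
        ∏ a, ((nCount G σ a : ℝ) / Real.exp 1) ^ nCount G σ a := by
    rw [Nat.cast_prod, ← Finset.card_univ, ← Finset.prod_const, ← Finset.prod_mul_distrib]
    exact Finset.prod_le_prod (fun _ _ => Nat.cast_nonneg _)
      fun a _ => factorial_le_mul_pow (hle a) hn
  have h2 : (∏ a, ((nCount G σ a : ℝ) / Real.exp 1) ^ nCount G σ a) * Q ^ n ≤
      (n / Real.exp 1) ^ n * Real.exp (n / 16) := by
    have e1 : (∏ a, ((nCount G σ a : ℝ) / Real.exp 1) ^ nCount G σ a) * Q ^ n =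
        (n / Real.exp 1) ^ n * ∏ a, (Q * nCount G σ a / n) ^ nCount G σ a := by
      have key : ∀ x : ℝ, x ^ n = ∏ a, x ^ nCount G σ a := fun x => by
        rw [Finset.prod_pow_eq_pow_sum, hsumN]
      rw [key Q, key (n / Real.exp 1), ← Finset.prod_mul_distrib, ← Finset.prod_mul_distrib]
      refine Finset.prod_congr rfl fun a _ => ?_
      rw [← mul_pow, ← mul_pow]
      congr 1
      field_simp
    have e2 : ∏ a, (Q * nCount G σ a / n) ^ nCount G σ a ≤
        ∏ a, Real.exp (nCount G σ a * (Q * nCount G σ a / n - 1)) := by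
      refine Finset.prod_le_prod (fun _ _ => by positivity) fun a _ => ?_
      rw [Real.exp_nat_mul]
      refine pow_le_pow_left₀ (by positivity) ?_ _
      have := Real.add_one_le_exp (Q * nCount G σ a / n - 1)
      linarith
    have e3 : ∑ a, (nCount G σ a : ℝ) * (Q * nCount G σ a / n - 1) =
        n * (Q * ∑ a, ((nCount G σ a : ℝ) / n - 1 / Q) ^ 2) := by
      have : ∀ a, ((nCount G σ a : ℝ) / n - 1 / Q) ^ 2 =
          (1 / (n * Q)) * (nCount G σ a * (Q * nCount G σ a / n - 1)) -
            (1 / (n * Q)) * nCount G σ a + 1 / Q ^ 2 := by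
        intro a
        field_simp
        ring
      simp only [this, Finset.sum_add_distrib, Finset.sum_sub_distrib, ← Finset.mul_sum, hsum,
        Finset.sum_const, Finset.card_univ, nsmul_eq_mul, ← hQd]
      generalize ∑ a, (nCount G σ a : ℝ) * (Q * nCount G σ a / n - 1) = T
      field_simp
      ring
    rw [e1]
    refine mul_le_mul_of_nonneg_left (e2.trans ?_) (by positivity)
    rw [← Real.exp_sum, e3, Real.exp_le_exp, show (n : ℝ) / 16 = n * (1 / 16) by ring]
    refine mul_le_mul_of_nonneg_left ?_ hn0.le
    calc Q * ∑ a, ((nCount G σ a : ℝ) / n - 1 / Q) ^ 2 ≤ Q * (1 / (16 * Q)) := by gcongr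
      _ = 1 / 16 := by field_simp
  calc ((∏ a, (nCount G σ a).factorial : ℕ) : ℝ) * Q ^ n ≤ (Real.exp 1 * n) ^ Fintype.card G *
        (∏ a, ((nCount G σ a : ℝ) / Real.exp 1) ^ nCount G σ a) * Q ^ n := by gcongr
    _ = (Real.exp 1 * n) ^ Fintype.card G *
        ((∏ a, ((nCount G σ a : ℝ) / Real.exp 1) ^ nCount G σ a) * Q ^ n) := by ring
    _ ≤ (Real.exp 1 * n) ^ Fintype.card G * ((n / Real.exp 1) ^ n * Real.exp (n / 16)) := by
        gcongr
    _ = _ := by ring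

/-- Configurations whose empirical distribution is far from uniform in `ℓ¹`. -/
def atypical (G : Type) [Group G] [Fintype G] (n : ℕ) : Set (Config G n) :=
  {τ | 3 / 4 < ∑ a, |(nCount G τ a : ℝ) / n - 1 / (Fintype.card G : ℝ)|}

theorem sum_exp_sign_le (s : G → ℝ) (hs : ∀ a, s a ^ 2 = 1) :
    ∑ a, Real.exp (1 / 4 * (s a - (∑ b, s b) / Fintype.card G)) ≤
      Fintype.card G * Real.exp (1 / 16) := by
  have hQ : (0 : ℝ) < Fintype.card G := by exact_mod_cast Fintype.card_pos
  set Q : ℝ := (Fintype.card G : ℝ) with hQd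
  set m := (∑ b, s b) / Q with hm
  have hs1 : ∀ a, |s a| ≤ 1 := fun a => by rw [← sq_le_one_iff_abs_le_one, hs a]
  have hsm : ∑ b, s b = Q * m := by rw [hm]; field_simp
  have hm1 : |m| ≤ 1 := by
    rw [hm, abs_div, abs_of_pos hQ, div_le_one hQ]
    refine (Finset.abs_sum_le_sum_abs _ _).trans ((Finset.sum_le_sum fun a _ => hs1 a).trans ?_)
    simp [hQd]
  have h1 : ∀ a, Real.exp (1 / 4 * (s a - m)) ≤
      1 + 1 / 4 * (s a - m) + 1 / 16 * (s a - m) ^ 2 := by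
    intro a
    have hz : |1 / 4 * (s a - m)| ≤ 1 := by
      have := abs_le.1 (hs1 a)
      have := abs_le.1 hm1
      rw [abs_le]
      constructor <;> linarith
    have := (abs_le.1 (Real.abs_exp_sub_one_sub_id_le hz)).2
    nlinarith
  have h2 : ∀ a, 1 + 1 / 4 * (s a - m) + 1 / 16 * (s a - m) ^ 2 =
      (1 - m / 4 + 1 / 16 + m ^ 2 / 16) + (1 / 4 - m / 8) * s a := by
    intro a
    have := hs a
    linear_combination (1 / 16 : ℝ) * this
  refine (Finset.sum_le_sum fun a _ => h1 a).trans ?_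
  simp only [h2, Finset.sum_add_distrib, ← Finset.mul_sum, hsm, Finset.sum_const,
    Finset.card_univ, nsmul_eq_mul, ← hQd]
  have h3 := Real.add_one_le_exp (1 / 16 : ℝ)
  have h4 : Q * (1 / 16 + 1) ≤ Q * Real.exp (1 / 16) := by gcongr
  nlinarith [mul_nonneg hQ.le (sq_nonneg m)]

theorem card_atypical_le (hn : 1 ≤ n) :
    ((Finset.univ.filter fun τ : Config G n => τ ∈ atypical G n).card : ℝ) ≤
      2 ^ Fintype.card G * (Fintype.card G : ℝ) ^ n * Real.exp (-(n / 8)) := by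
  have hn0 : (0 : ℝ) < n := by exact_mod_cast hn
  have hQ : (0 : ℝ) < Fintype.card G := by exact_mod_cast Fintype.card_pos
  set Q : ℝ := (Fintype.card G : ℝ) with hQd
  let S : (G → Bool) → G → ℝ := fun s a => if s a then 1 else -1
  let F : (G → Bool) → Config G n → ℝ := fun s τ =>
    Real.exp (-(3 * n / 16)) * ∏ i, Real.exp (1 / 4 * (S s (τ i) - (∑ b, S s b) / Q))
  have hF0 : ∀ s τ, 0 ≤ F s τ := fun s τ => by positivity
  have h1 : ∀ τ : Config G n, (if τ ∈ atypical G n then (1 : ℝ) else 0) ≤ ∑ s, F s τ := by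
    intro τ
    split_ifs with hτ
    · let s₀ : G → Bool := fun a => decide (0 ≤ (nCount G τ a : ℝ) / n - 1 / Q)
      refine le_trans ?_ (Finset.single_le_sum (fun s _ => hF0 s τ) (Finset.mem_univ s₀))
      have hsgn : ∀ a, |(nCount G τ a : ℝ) / n - 1 / Q| =
          ((nCount G τ a : ℝ) / n - 1 / Q) * S s₀ a := by
        intro a
        by_cases h : 0 ≤ (nCount G τ a : ℝ) / n - 1 / Q
        · simp only [S, s₀, h, decide_true, if_true, mul_one, abs_of_nonneg]
        · simp only [S, s₀, h, decide_false, Bool.false_eq_true, if_false, mul_neg, mul_one,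
            abs_of_neg (not_le.1 h)]
      have hsum : ∑ i, (S s₀ (τ i) - (∑ b, S s₀ b) / Q) =
          n * ∑ a, |(nCount G τ a : ℝ) / n - 1 / Q| := by
        simp only [hsgn, Finset.sum_sub_distrib, sub_mul]
        rw [← sum_nCount_smul τ (S s₀)]
        simp only [smul_eq_mul, Finset.sum_const, Finset.card_univ, Fintype.card_fin, nsmul_eq_mul,
          ← Finset.mul_sum]
        rw [mul_sub, Finset.mul_sum]
        congr 1
        · exact Finset.sum_congr rfl fun a _ => by field_simp
        · ring
      simp only [F]
      rw [← Real.exp_sum, ← Finset.mul_sum, hsum, ← Real.exp_add, Real.one_le_exp_iff]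
      have hτ' : 3 / 4 < ∑ a, |(nCount G τ a : ℝ) / n - 1 / Q| := hτ
      nlinarith
    · exact Finset.sum_nonneg fun s _ => hF0 s τ
  have h2 : ∀ s, ∑ τ, F s τ ≤ Q ^ n * Real.exp (-(n / 8)) := by
    intro s
    simp only [F]
    rw [← Finset.mul_sum,
      ← Fintype.sum_pow (fun a => Real.exp (1 / 4 * (S s a - (∑ b, S s b) / Q))) n]
    have := sum_exp_sign_le (S s) (fun a => by simp only [S]; split_ifs <;> norm_num)
    calc Real.exp (-(3 * n / 16)) *
          (∑ a, Real.exp (1 / 4 * (S s a - (∑ b, S s b) / Q))) ^ n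
        ≤ Real.exp (-(3 * n / 16)) * (Q * Real.exp (1 / 16)) ^ n := by gcongr
      _ = Q ^ n * Real.exp (-(n / 8)) := by
        rw [mul_pow, ← Real.exp_nat_mul, mul_left_comm, ← Real.exp_add]
        congr 2
        ring
  have h3 : ((Finset.univ.filter fun τ : Config G n => τ ∈ atypical G n).card : ℝ) =
      ∑ τ : Config G n, if τ ∈ atypical G n then (1 : ℝ) else 0 := by
    rw [Finset.sum_ite, Finset.sum_const_zero, add_zero, Finset.sum_const, nsmul_eq_mul, mul_one]
  rw [h3]
  refine (Finset.sum_le_sum fun τ _ => h1 τ).trans ?_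
  rw [Finset.sum_comm]
  refine (Finset.sum_le_sum fun s _ => h2 s).trans (le_of_eq ?_)
  rw [Finset.sum_const, Finset.card_univ, Fintype.card_fun, Fintype.card_bool, nsmul_eq_mul]
  push_cast
  ring

/-- At any time, the chain started from a typical configuration is very unlikely to be atypical. -/
theorem prob_atypical_le (hn : 2 ≤ n) (σ : Config G n)
    (hσ : ∑ a, ((nCount G σ a : ℝ) / n - 1 / (Fintype.card G : ℝ)) ^ 2 ≤
      1 / (16 * (Fintype.card G : ℝ))) (t : ℕ) :
    prob G σ t (atypical G n) ≤
      2 ^ Fintype.card G * (Real.exp 1 * n) ^ Fintype.card G * Real.exp (-(n / 16)) := by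
  have hn0 : (0 : ℝ) < n := by exact_mod_cast (show 0 < n by omega)
  have hQ : (0 : ℝ) < Fintype.card G := by exact_mod_cast Fintype.card_pos
  have hinv : ∀ (π : Equiv.Perm (Fin n)) (τ : Config G n),
      τ ∘ π ∈ atypical G n ↔ τ ∈ atypical G n := by
    intro π τ
    simp only [atypical, Set.mem_ofPred_eq, nCount_comp_perm]
  have h1 := card_orbit_mul_prob_le hn σ t hinv
  have h2 := card_atypical_le (G := G) (show 1 ≤ n by omega)
  have h3 : (n.factorial : ℝ) ≤
      ((∏ a, (nCount G σ a).factorial : ℕ) : ℝ) * (orbit σ).card := by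
    exact_mod_cast factorial_le_prod_mul_card_orbit σ
  have h4 := prod_factorial_nCount_le (show 1 ≤ n by omega) σ hσ
  have h5 := pow_div_exp_le_factorial n
  set Q : ℝ := (Fintype.card G : ℝ) with hQd
  set P : ℝ := ((∏ a, (nCount G σ a).factorial : ℕ) : ℝ) with hP
  set p := prob G σ t (atypical G n) with hp
  set O : ℝ := ((orbit σ).card : ℝ) with hO
  set K : ℝ := (Real.exp 1 * n) ^ Fintype.card G with hK
  set W : ℝ := (n / Real.exp 1) ^ n with hW
  have hW0 : 0 < W := by positivity
  have hP0 : 0 ≤ P := Nat.cast_nonneg _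
  have hp0 : 0 ≤ p := Finset.sum_nonneg fun τ _ => law_nonneg σ t τ
  have h6 : W * Q ^ n * p ≤ W * Q ^ n *
      (2 ^ Fintype.card G * K * Real.exp (-(n / 16))) := by
    calc W * Q ^ n * p ≤ P * O * Q ^ n * p := by
          gcongr
          exact h5.trans h3
      _ = P * Q ^ n * (O * p) := by ring
      _ ≤ P * Q ^ n * (2 ^ Fintype.card G * Q ^ n * Real.exp (-(n / 8))) := by
          refine mul_le_mul_of_nonneg_left (h1.trans h2) (by positivity)
      _ ≤ K * W * Real.exp (n / 16) * (2 ^ Fintype.card G * Q ^ n * Real.exp (-(n / 8))) := by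
          gcongr
      _ = _ := by
          have : Real.exp (-((n : ℝ) / 16)) = Real.exp (n / 16) * Real.exp (-(n / 8)) := by
            rw [← Real.exp_add]
            congr 1
            ring
          rw [this]
          ring
  exact le_of_mul_le_mul_left h6 (by positivity)

end Typical

end PR

namespace PR

open scoped InnerProductSpace Matrix

section Frobenius

variable {d : ℕ}

/-- Complex matrices as a real inner product space with the Hilbert-Schmidt inner product. -/
abbrev HSSpace (d : ℕ) := PiLp 2 fun _ : Fin d × Fin d => ℂ

/-- The matrix, viewed as a vector of the Hilbert-Schmidt space. -/
def toHS : Matrix (Fin d) (Fin d) ℂ →ₗ[ℝ] HSSpace d where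
  toFun A := WithLp.toLp 2 fun p => A p.1 p.2
  map_add' _ _ := rfl
  map_smul' _ _ := rfl

/-- The matrix underlying a vector of the Hilbert-Schmidt space. -/
def ofHS : HSSpace d →ₗ[ℝ] Matrix (Fin d) (Fin d) ℂ where
  toFun x := Matrix.of fun i j => x (i, j)
  map_add' _ _ := rfl
  map_smul' _ _ := rfl

theorem toHS_apply (A : Matrix (Fin d) (Fin d) ℂ) (p : Fin d × Fin d) :
    toHS A p = A p.1 p.2 := rfl

theorem toHS_ofHS (x : HSSpace d) : toHS (ofHS x) = x := rfl

theorem inner_toHS (A B : Matrix (Fin d) (Fin d) ℂ) :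
    ⟪toHS A, toHS B⟫_ℝ = (Matrix.trace (Aᴴ * B)).re := by
  rw [PiLp.inner_apply, Fintype.sum_prod_type, Finset.sum_comm, Matrix.trace, Complex.re_sum]
  refine Finset.sum_congr rfl fun j _ => ?_
  rw [Matrix.diag_apply, Matrix.mul_apply, Complex.re_sum]
  refine Finset.sum_congr rfl fun i _ => ?_
  simp only [toHS_apply, Complex.inner, Matrix.conjTranspose_apply, Complex.star_def,
    mul_comm]

theorem norm_toHS (A : Matrix (Fin d) (Fin d) ℂ) : ‖toHS A‖ = hsNorm A := by
  rw [PiLp.norm_eq_of_L2, hsNorm, Fintype.sum_prod_type]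
  rfl

theorem hsNorm_mul_le (A B : Matrix (Fin d) (Fin d) ℂ) :
    hsNorm (A * B) ≤ hsNorm A * hsNorm B := by
  let := Matrix.frobeniusNormedAddCommGroup (m := Fin d) (n := Fin d) (α := ℂ)
  have h : ∀ A : Matrix (Fin d) (Fin d) ℂ, hsNorm A = ‖A‖ := fun A => by
    rw [Matrix.frobenius_norm_def, hsNorm, Real.sqrt_eq_rpow]
    simp
  simp only [h]
  exact Matrix.frobenius_norm_mul A B

/-- Right multiplication by a matrix on the Hilbert-Schmidt space. -/
def hsMulRight (U : Matrix (Fin d) (Fin d) ℂ) : HSSpace d →ₗ[ℝ] HSSpace d :=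
  toHS ∘ₗ LinearMap.mulRight ℝ U ∘ₗ ofHS

theorem hsMulRight_toHS (A U : Matrix (Fin d) (Fin d) ℂ) :
    hsMulRight U (toHS A) = toHS (A * U) := rfl

theorem inner_hsMulRight_conjTranspose (U : Matrix (Fin d) (Fin d) ℂ) (w : HSSpace d) :
    ⟪w, hsMulRight Uᴴ w⟫_ℝ = ⟪w, hsMulRight U w⟫_ℝ := by
  rw [← toHS_ofHS w, hsMulRight_toHS, hsMulRight_toHS, inner_toHS, inner_toHS]
  set A := ofHS w
  have : Matrix.trace (Aᴴ * (A * Uᴴ)) = star (Matrix.trace (Aᴴ * (A * U))) := by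
    rw [← Matrix.trace_conjTranspose, Matrix.conjTranspose_mul, Matrix.conjTranspose_mul,
      Matrix.conjTranspose_conjTranspose, Matrix.mul_assoc, Matrix.trace_mul_comm, Matrix.mul_assoc,
      Matrix.trace_mul_comm, Matrix.mul_assoc, Matrix.trace_mul_comm Uᴴ, Matrix.mul_assoc]
  rw [this, Complex.star_def, Complex.conj_re]

theorem norm_hsMulRight (U : Matrix.unitaryGroup (Fin d) ℂ) (w : HSSpace d) :
    ‖hsMulRight (U : Matrix (Fin d) (Fin d) ℂ) w‖ = ‖w‖ := by
  have h : (U : Matrix (Fin d) (Fin d) ℂ) * (U : Matrix (Fin d) (Fin d) ℂ)ᴴ = 1 :=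
    Matrix.mem_unitaryGroup_iff.1 U.2
  rw [← sq_eq_sq₀ (norm_nonneg _) (norm_nonneg _), ← real_inner_self_eq_norm_sq,
    ← real_inner_self_eq_norm_sq, ← toHS_ofHS w, hsMulRight_toHS, inner_toHS, inner_toHS,
    Matrix.conjTranspose_mul, Matrix.mul_assoc, Matrix.trace_mul_comm, Matrix.mul_assoc,
    Matrix.mul_assoc, h, Matrix.mul_one]

end Frobenius

section Representation

variable {G : Type} [Group G] [Fintype G] {n d : ℕ}

theorem sum_rep_eq_zero (ρ : UnitaryRep G d) (hnt : IsNontrivialRep G ρ)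
    (hirr : IsIrreducibleRep G ρ) : ∑ g, (ρ g : Matrix (Fin d) (Fin d) ℂ) = 0 := by
  let W : Submodule ℂ (Fin d → ℂ) :=
    { carrier := {w | ∀ a, (ρ a : Matrix (Fin d) (Fin d) ℂ) *ᵥ w = w}
      add_mem' := fun {x y} hx hy a => by rw [Matrix.mulVec_add, hx a, hy a]
      zero_mem' := fun a => Matrix.mulVec_zero _
      smul_mem' := fun c x hx a => by rw [Matrix.mulVec_smul, hx a] }
  have hW : ∀ a : G, ∀ w ∈ W, ((ρ a : Matrix (Fin d) (Fin d) ℂ)).mulVec w ∈ W := by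
    intro a w hw
    rwa [hw a]
  rcases hirr W hW with h | h
  · ext1 i j
    have hmem : (∑ g, (ρ g : Matrix (Fin d) (Fin d) ℂ)) *ᵥ Pi.single j 1 ∈ W := by
      intro a
      rw [Matrix.mulVec_mulVec, Finset.mul_sum]
      congr 1
      rw [← Equiv.sum_comp (Equiv.mulLeft a) fun g => (ρ g : Matrix (Fin d) (Fin d) ℂ)]
      simp
    rw [h, Submodule.mem_bot] at hmem
    have := congrFun hmem i
    simpa using this
  · obtain ⟨a, ha⟩ := hnt
    refine absurd ?_ ha
    refine Matrix.ext_of_mulVec_single fun j => ?_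
    have : (Pi.single j 1 : Fin d → ℂ) ∈ W := h ▸ Submodule.mem_top
    rw [this a, Matrix.one_mulVec]

theorem dim_le_card (ρ : UnitaryRep G d) (hirr : IsIrreducibleRep G ρ) :
    d ≤ Fintype.card G := by
  rcases Nat.eq_zero_or_pos d with rfl | hd
  · exact Nat.zero_le _
  let e : Fin d → ℂ := Pi.single ⟨0, hd⟩ 1
  let f : G → Fin d → ℂ := fun g => (ρ g : Matrix (Fin d) (Fin d) ℂ) *ᵥ e
  have hinv : ∀ a : G, ∀ w ∈ Submodule.span ℂ (Set.range f),
      ((ρ a : Matrix (Fin d) (Fin d) ℂ)).mulVec w ∈ Submodule.span ℂ (Set.range f) := by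
    intro a w hw
    induction hw using Submodule.span_induction with
    | mem x hx =>
      obtain ⟨g, rfl⟩ := hx
      refine Submodule.subset_span ⟨a * g, ?_⟩
      simp [f, Matrix.mulVec_mulVec]
    | zero => rw [Matrix.mulVec_zero]; exact Submodule.zero_mem _
    | add x y _ _ hx hy => rw [Matrix.mulVec_add]; exact Submodule.add_mem _ hx hy
    | smul c x _ hx => rw [Matrix.mulVec_smul]; exact Submodule.smul_mem _ c hx
  have hmem : e ∈ Submodule.span ℂ (Set.range f) :=
    Submodule.subset_span ⟨1, by simp [f]⟩
  have htop : Submodule.span ℂ (Set.range f) = ⊤ := by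
    refine (hirr _ hinv).resolve_left fun h => ?_
    rw [h, Submodule.mem_bot] at hmem
    have := congrFun hmem ⟨0, hd⟩
    simp [e] at this
  have := finrank_range_le_card (R := ℂ) f
  rwa [Set.finrank, htop, finrank_top, Module.finrank_fin_fun] at this

theorem norm_toHS_rep_sq (ρ : UnitaryRep G d) (g : G) :
    ‖toHS (ρ g : Matrix (Fin d) (Fin d) ℂ)‖ ^ 2 = d := by
  have h : (ρ g : Matrix (Fin d) (Fin d) ℂ)ᴴ * (ρ g : Matrix (Fin d) (Fin d) ℂ) = 1 :=
    Matrix.mem_unitaryGroup_iff'.1 (ρ g).2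
  rw [← real_inner_self_eq_norm_sq, inner_toHS, h]
  simp

theorem toHS_yCoeff (ρ : UnitaryRep G d) (σast τ : Config G n) (a : G) :
    toHS (yCoeff G ρ σast τ a) =
      siteAvg (fun g => toHS (ρ g : Matrix (Fin d) (Fin d) ℂ))
        (Finset.univ.filter fun i => σast i = a) τ := by
  have h : yCoeff G ρ σast τ a = ((nCount G σast a : ℝ))⁻¹ •
      ∑ i ∈ Finset.univ.filter (fun i => σast i = a), (ρ (τ i) : Matrix (Fin d) (Fin d) ℂ) := by
    rw [← Finset.sum_fiberwise_of_maps_to (t := Finset.univ) (g := τ)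
      (fun _ _ => Finset.mem_univ _), Finset.smul_sum, yCoeff]
    refine Finset.sum_congr rfl fun b _ => ?_
    rw [Finset.sum_congr rfl (g := fun _ => (ρ b : Matrix (Fin d) (Fin d) ℂ)), Finset.sum_const,
      Finset.filter_filter, ← Nat.cast_smul_eq_nsmul ℝ, smul_smul, nab, Complex.coe_smul,
      div_eq_inv_mul]
    intro i hi
    rw [(Finset.mem_filter.1 hi).2]
  rw [h, map_smul, map_sum]
  rfl

theorem sum_inner_hsMulRight_le (ρ : UnitaryRep G d) (hn : 1 ≤ n) (σ : Config G n)
    (w : HSSpace d) :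
    ∑ j, ⟪w, hsMulRight (ρ (σ j) : Matrix (Fin d) (Fin d) ℂ) w⟫_ℝ ≤
      n * ‖siteAvg (fun g => toHS (ρ g : Matrix (Fin d) (Fin d) ℂ)) Finset.univ σ‖ * ‖w‖ ^ 2 := by
  have hn0 : (0 : ℝ) < n := by exact_mod_cast hn
  set X : Matrix (Fin d) (Fin d) ℂ := ∑ j, (ρ (σ j) : Matrix (Fin d) (Fin d) ℂ) with hX
  have h1 : ∑ j, hsMulRight (ρ (σ j) : Matrix (Fin d) (Fin d) ℂ) w = toHS (ofHS w * X) := by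
    rw [hX, Finset.mul_sum, map_sum]
    rfl
  have h2 : n * ‖siteAvg (fun g => toHS (ρ g : Matrix (Fin d) (Fin d) ℂ)) Finset.univ σ‖ =
      ‖toHS X‖ := by
    rw [siteAvg, ← map_sum, ← hX, Finset.card_univ, Fintype.card_fin, norm_smul, norm_inv,
      Real.norm_natCast, mul_inv_cancel_left₀ hn0.ne']
  rw [h2, ← inner_sum, h1]
  refine (real_inner_le_norm _ _).trans ?_
  rw [norm_toHS]
  have h3 := hsNorm_mul_le (ofHS w) X
  rw [← norm_toHS (ofHS w), toHS_ofHS, ← norm_toHS X] at h3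
  nlinarith [norm_nonneg w]

/-- At a typical configuration the drift is at most three quarters of the neutral one. -/
theorem sum_inner_le_of_notMem_atypical {E : Type} [NormedAddCommGroup E] [InnerProductSpace ℝ E]
    {R : G → E →ₗ[ℝ] E} (hiso : ∀ h w, ‖R h w‖ ≤ ‖w‖) (hzero : ∀ w, ∑ h, R h w = 0)
    {σ : Config G n} (hσ : σ ∉ atypical G n) (hn : 1 ≤ n) (w : E) :
    ∑ j, ⟪w, R (σ j) w⟫_ℝ ≤ n * (3 / 4) * ‖w‖ ^ 2 := by
  have hn0 : (0 : ℝ) < n := by exact_mod_cast hn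
  have hσ' : ∑ a, |(nCount G σ a : ℝ) / n - 1 / (Fintype.card G : ℝ)| ≤ 3 / 4 := not_lt.1 hσ
  have hz : ∑ a, ⟪w, R a w⟫_ℝ = 0 := by rw [← inner_sum, hzero, inner_zero_right]
  have h1 : ∑ j, ⟪w, R (σ j) w⟫_ℝ =
      n * ∑ a, ((nCount G σ a : ℝ) / n - 1 / (Fintype.card G : ℝ)) * ⟪w, R a w⟫_ℝ := by
    rw [← sum_nCount_smul σ (fun a => ⟪w, R a w⟫_ℝ)]
    simp only [sub_mul, Finset.sum_sub_distrib, ← Finset.mul_sum, hz, mul_zero, sub_zero]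
    rw [Finset.mul_sum]
    refine Finset.sum_congr rfl fun a _ => ?_
    rw [smul_eq_mul]
    field_simp
  rw [h1, mul_assoc]
  refine mul_le_mul_of_nonneg_left ?_ hn0.le
  refine le_trans (Finset.sum_le_sum fun a _ => ?_)
    ((Finset.sum_mul _ _ _).symm.trans_le (mul_le_mul_of_nonneg_right hσ' (sq_nonneg ‖w‖)))
  refine (le_abs_self _).trans ?_
  rw [abs_mul]
  refine mul_le_mul_of_nonneg_left ?_ (abs_nonneg _)
  refine (abs_real_inner_le_norm _ _).trans ?_
  nlinarith [hiso a w, norm_nonneg w]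

end Representation

end PR

namespace PR

open scoped InnerProductSpace

section Decay

variable {G : Type} [Group G] [Fintype G] {n : ℕ}
variable {E : Type} [NormedAddCommGroup E] [InnerProductSpace ℝ E]
variable {v : G → E} {R : G → E →ₗ[ℝ] E} {Q : ℝ} {A : Finset (Fin n)}

theorem sum_filter_le_exp_mul {α : Type*} [Fintype α] {w f : α → ℝ} (hw : ∀ τ, 0 ≤ w τ)
    {P : α → Prop} {c : ℝ} (hP : ∀ τ, P τ → c ≤ f τ) :
    ∑ τ ∈ Finset.univ.filter P, w τ ≤ Real.exp (-c) * ∑ τ, w τ * Real.exp (f τ) := by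
  rw [Finset.mul_sum, Finset.sum_filter]
  refine Finset.sum_le_sum fun τ _ => ?_
  split_ifs with h
  · have h1 : 1 ≤ Real.exp (-c) * Real.exp (f τ) := by
      rw [← Real.exp_add, Real.one_le_exp_iff]
      linarith [hP τ h]
    calc w τ = w τ * 1 := (mul_one _).symm
      _ ≤ w τ * (Real.exp (-c) * Real.exp (f τ)) := mul_le_mul_of_nonneg_left h1 (hw τ)
      _ = _ := by ring
  · exact mul_nonneg (Real.exp_pos _).le (mul_nonneg (hw τ) (Real.exp_pos _).le)

theorem sum_law_mul_exp_norm_siteAvg_le (hn : 2 ≤ n) (hQ : 0 ≤ Q) (hv : ∀ g, ‖v g‖ ^ 2 ≤ Q)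
    {θ : ℝ} (hθ : 0 ≤ θ) (σ : Config G n) (t : ℕ) :
    ∑ τ, law G σ t τ * Real.exp (θ * ‖siteAvg v A τ‖ ^ 2) ≤ Real.exp (θ * Q) := by
  calc ∑ τ, law G σ t τ * Real.exp (θ * ‖siteAvg v A τ‖ ^ 2)
      ≤ ∑ τ, law G σ t τ * Real.exp (θ * Q) := by
        refine Finset.sum_le_sum fun τ _ => mul_le_mul_of_nonneg_left ?_ (law_nonneg _ _ _)
        rw [Real.exp_le_exp]
        exact mul_le_mul_of_nonneg_left (norm_siteAvg_sq_le hQ hv A τ) hθ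
    _ = Real.exp (θ * Q) := by rw [← Finset.sum_mul, sum_law hn, one_mul]

/-- Configurations whose overall average is still large `s` steps after the start. -/
def slow (v : G → E) (n : ℕ) (Q b : ℝ) (s : ℕ) : Set (Config G n) :=
  {τ | Real.exp 2 * Q * Real.exp (-(s / (2 * n))) + b <
    ‖siteAvg v (Finset.univ : Finset (Fin n)) τ‖ ^ 2}

theorem prob_slow_le (hn : 2 ≤ n) (hR : ∀ g h, v (g * h) = R h (v g))
    (hinv : ∀ h w, ⟪w, R h⁻¹ w⟫_ℝ = ⟪w, R h w⟫_ℝ) (hQ : 1 ≤ Q) (hv : ∀ g, ‖v g‖ ^ 2 ≤ Q)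
    (hiso : ∀ h w, ‖R h w‖ ≤ ‖w‖) (hzero : ∀ w, ∑ h, R h w = 0)
    (σ : Config G n) {p : ℝ} (hp : ∀ t, prob G σ t (atypical G n) ≤ p) (b : ℝ) (t s : ℕ) :
    prob G σ (t + s) (slow v n Q b s) ≤
      Real.exp (1 - n / (512 * Q ^ 3) * b) + s * p := by
  have hn0 : (0 : ℝ) < n := by exact_mod_cast (show 0 < n by omega)
  have hQ0 : 0 < Q := by linarith
  have hmom := sum_killed_mul_exp_le_of_sum_le (A := (Finset.univ : Finset (Fin n)))
    (B := fun _ => atypical G n) (w := law G σ t) hn hR hinv hQ hv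
    (by rw [Finset.card_univ, Fintype.card_fin]; nlinarith) (law_nonneg σ t)
    (h := fun _ => 3 / 4) (fun _ => le_rfl)
    (fun _ τ hτ => sum_inner_le_of_notMem_atypical hiso hzero hτ (by omega) _) s
    (H := 3 * s / (4 * n)) (by
      rw [Finset.sum_const, Finset.card_range, nsmul_eq_mul]
      refine le_of_eq ?_
      field_simp)
  have hstart := sum_law_mul_exp_norm_siteAvg_le (A := (Finset.univ : Finset (Fin n))) hn hQ0.le hv
    (θ := n / (512 * Q ^ 3) * Real.exp (-(2 * s / n) + 2 * (3 * s / (4 * n)) + 2))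
    (by positivity) σ t
  refine (prob_le_killed_add (B := fun _ => atypical G n) hn σ t s _).trans (add_le_add ?_ ?_)
  · refine (sum_filter_le_exp_mul
      (f := fun τ => n / (512 * Q ^ 3) * ‖siteAvg v (Finset.univ : Finset (Fin n)) τ‖ ^ 2)
      (c := n / (512 * Q ^ 3) * (Real.exp 2 * Q * Real.exp (-(s / (2 * n))) + b))
      (killed_nonneg (law_nonneg σ t) s)
      (fun τ hτ => mul_le_mul_of_nonneg_left (le_of_lt hτ) (by positivity))).trans ?_
    refine (mul_le_mul_of_nonneg_left
      (hmom.trans (mul_le_mul_of_nonneg_left hstart (Real.exp_pos _).le))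
      (Real.exp_pos _).le).trans (le_of_eq ?_)
    have he : Real.exp (-(2 * s / n) + 2 * (3 * s / (4 * n)) + 2) =
        Real.exp 2 * Real.exp (-(s / (2 * n))) := by
      rw [← Real.exp_add]
      congr 1
      field_simp
      ring
    rw [he, ← Real.exp_add, ← Real.exp_add]
    congr 1
    ring
  · refine (Finset.sum_le_sum fun r _ => hp _).trans (le_of_eq ?_)
    rw [Finset.sum_const, Finset.card_range, nsmul_eq_mul]

theorem sum_killed_slow_mul_exp_le (hn : 2 ≤ n) (hR : ∀ g h, v (g * h) = R h (v g))
    (hinv : ∀ h w, ⟪w, R h⁻¹ w⟫_ℝ = ⟪w, R h w⟫_ℝ) (hQ : 1 ≤ Q) (hv : ∀ g, ‖v g‖ ^ 2 ≤ Q)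
    (hiso : ∀ h w, ‖R h w‖ ≤ ‖w‖) (hzero : ∀ w, ∑ h, R h w = 0)
    (hmul : ∀ (σ : Config G n) w, ∑ j, ⟪w, R (σ j) w⟫_ℝ ≤
      n * ‖siteAvg v Finset.univ σ‖ * ‖w‖ ^ 2)
    (hA : (n : ℝ) ≤ 2 * Q * A.card) {w : Config G n → ℝ} (hw : ∀ τ, 0 ≤ w τ) {m L : ℕ}
    (hm : 1 ≤ m) (hL : L ≤ n * m) :
    ∑ τ, killed w (fun s => atypical G n ∪ slow v n Q (1 / m ^ 2) s) L τ *
        Real.exp (n / (512 * Q ^ 3) * ‖siteAvg v A τ‖ ^ 2) ≤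
      Real.exp 1 * ∑ τ, w τ * Real.exp (n / (512 * Q ^ 3) *
        Real.exp (-(2 * L / n) + 2 * (8 * Real.exp 1 * Q + 1) + 2) * ‖siteAvg v A τ‖ ^ 2) := by
  have hn0 : (0 : ℝ) < n := by exact_mod_cast (show 0 < n by omega)
  have hm0 : (0 : ℝ) < m := by exact_mod_cast hm
  have hQ0 : 0 < Q := by linarith
  set b : ℕ → ℝ := fun s => Real.exp 1 * Q * Real.exp (-(1 / (4 * (n : ℝ)))) ^ s + 1 / m with hb
  have hb0 : ∀ s, 0 ≤ b s := fun s => by positivity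
  refine sum_killed_mul_exp_le_of_sum_le hn hR hinv hQ hv hA hw
    (h := fun s => min (3 / 4) (b s)) (fun s => min_le_left _ _) ?_ L ?_
  · intro s σ hσ
    rw [Set.mem_union, not_or] at hσ
    obtain ⟨h1, h2⟩ := hσ
    have h2' : ‖siteAvg v (Finset.univ : Finset (Fin n)) σ‖ ^ 2 ≤
        Real.exp 2 * Q * Real.exp (-(s / (2 * n))) + 1 / m ^ 2 := not_lt.1 h2
    rcases min_choice (3 / 4 : ℝ) (b s) with h | h <;> rw [h]
    · exact sum_inner_le_of_notMem_atypical hiso hzero h1 (by omega) _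
    · refine (hmul σ _).trans ?_
      refine mul_le_mul_of_nonneg_right (mul_le_mul_of_nonneg_left ?_ hn0.le) (sq_nonneg _)
      refine abs_le_of_sq_le_sq' ?_ (hb0 s) |>.2
      refine h2'.trans ?_
      have e1 : Real.exp (-(s / (2 * n))) = (Real.exp (-(1 / (4 * (n : ℝ)))) ^ s) ^ 2 := by
        rw [← pow_mul, ← Real.exp_nat_mul]
        congr 1
        push_cast
        field_simp
        ring
      have e2 : Real.exp 2 = Real.exp 1 ^ 2 := by
        rw [← Real.exp_nat_mul]; norm_num
      rw [e1, e2, hb]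
      set u := Real.exp (-(1 / (4 * (n : ℝ)))) ^ s
      have h3 : Q ≤ Q ^ 2 := by nlinarith
      have h4 : Real.exp 1 ^ 2 * Q * u ^ 2 ≤ Real.exp 1 ^ 2 * Q ^ 2 * u ^ 2 := by gcongr
      have h5 : 0 ≤ 2 * (Real.exp 1 * Q * u) * (1 / m) := by positivity
      have h6 : (1 : ℝ) / m ^ 2 = (1 / m) ^ 2 := by rw [div_pow, one_pow]
      simp only []
      rw [h6]
      nlinarith
  · refine (Finset.sum_le_sum fun s _ => min_le_right _ _).trans ?_
    simp only [hb]
    rw [Finset.sum_add_distrib, ← Finset.mul_sum, Finset.sum_const, Finset.card_range, nsmul_eq_mul]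
    have h1 := sum_geom_exp_le (show 1 ≤ n by omega) L
    have h2 : (L : ℝ) * (1 / m) ≤ n := by
      rw [mul_one_div, div_le_iff₀ hm0]
      exact_mod_cast hL
    have h3 : Real.exp 1 * Q * ∑ j ∈ Finset.range L, Real.exp (-(1 / (4 * (n : ℝ)))) ^ j ≤
        Real.exp 1 * Q * (8 * n) := mul_le_mul_of_nonneg_left h1 (by positivity)
    linarith

theorem prob_le_killed_slow_add (hn : 2 ≤ n) (hR : ∀ g h, v (g * h) = R h (v g))
    (hinv : ∀ h w, ⟪w, R h⁻¹ w⟫_ℝ = ⟪w, R h w⟫_ℝ) (hQ : 1 ≤ Q) (hv : ∀ g, ‖v g‖ ^ 2 ≤ Q)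
    (hiso : ∀ h w, ‖R h w‖ ≤ ‖w‖) (hzero : ∀ w, ∑ h, R h w = 0)
    (σ : Config G n) {p : ℝ} (hp : ∀ t, prob G σ t (atypical G n) ≤ p) {b : ℝ} {t L T : ℕ}
    (hL : L ≤ T) (D : Set (Config G n)) :
    prob G σ (t + L) D ≤
      ∑ τ ∈ Finset.univ.filter (fun τ => τ ∈ D),
        killed (law G σ t) (fun s => atypical G n ∪ slow v n Q b s) L τ +
      T * (p + (Real.exp (1 - n / (512 * Q ^ 3) * b) + T * p)) := by
  have hp0 : 0 ≤ p := (Finset.sum_nonneg fun τ _ => law_nonneg σ 0 τ).trans (hp 0)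
  have hLT : (L : ℝ) ≤ T := by exact_mod_cast hL
  refine (prob_le_killed_add (B := fun s => atypical G n ∪ slow v n Q b s) hn σ t L D).trans
    (add_le_add le_rfl ?_)
  calc ∑ r ∈ Finset.range L, prob G σ (t + r) (atypical G n ∪ slow v n Q b r)
      ≤ ∑ r ∈ Finset.range L, (p + (Real.exp (1 - n / (512 * Q ^ 3) * b) + T * p)) := by
        refine Finset.sum_le_sum fun r hr => (prob_union_le σ _ _ _).trans
          (add_le_add (hp _)
            ((prob_slow_le hn hR hinv hQ hv hiso hzero σ hp b t r).trans
              (add_le_add le_rfl (mul_le_mul_of_nonneg_right ?_ hp0))))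
        have : r ≤ T := (Finset.mem_range.1 hr).le.trans hL
        exact_mod_cast this
    _ = L * (p + (Real.exp (1 - n / (512 * Q ^ 3) * b) + T * p)) := by
        rw [Finset.sum_const, Finset.card_range, nsmul_eq_mul]
    _ ≤ _ := mul_le_mul_of_nonneg_right hLT (by positivity)

theorem prob_norm_siteAvg_ge_le (hn : 2 ≤ n) (hR : ∀ g h, v (g * h) = R h (v g))
    (hinv : ∀ h w, ⟪w, R h⁻¹ w⟫_ℝ = ⟪w, R h w⟫_ℝ) (hQ : 1 ≤ Q) (hv : ∀ g, ‖v g‖ ^ 2 ≤ Q)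
    (hiso : ∀ h w, ‖R h w‖ ≤ ‖w‖) (hzero : ∀ w, ∑ h, R h w = 0)
    (hmul : ∀ (σ : Config G n) w, ∑ j, ⟪w, R (σ j) w⟫_ℝ ≤
      n * ‖siteAvg v Finset.univ σ‖ * ‖w‖ ^ 2)
    (hA : (n : ℝ) ≤ 2 * Q * A.card)
    (σ : Config G n) {p : ℝ} (hp : ∀ t, prob G σ t (atypical G n) ≤ p)
    {m : ℕ} (hm : 1 ≤ m) (hlog : Real.log n ≤ m) {K : ℝ}
    (hK : K = Real.exp (2 * (8 * Real.exp 1 * Q + 1) + 2)) (t : ℕ) {r : ℝ} (hr : 0 < r) :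
    prob G σ t {τ | r * (1 / Real.sqrt n + Real.exp (-(t : ℝ) / n) * ‖siteAvg v A σ‖) ≤
        ‖siteAvg v A τ‖} ≤
      Real.exp (1 + 1 / (512 * Q ^ 3) * K * Q) * Real.exp (-(1 / (512 * Q ^ 3) * r ^ 2)) +
        (n * m : ℕ) * (p + (Real.exp (1 - n / (512 * Q ^ 3) * (1 / m ^ 2)) + (n * m : ℕ) * p)) := by
  have hn0 : (0 : ℝ) < n := by exact_mod_cast (show 0 < n by omega)
  have hQ0 : 0 < Q := by linarith
  have hK0 : 0 < K := hK ▸ Real.exp_pos _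
  have hp0 : 0 ≤ p := (Finset.sum_nonneg fun τ _ => law_nonneg σ 0 τ).trans (hp 0)
  set D : Set (Config G n) := {τ | r * (1 / Real.sqrt n +
    Real.exp (-(t : ℝ) / n) * ‖siteAvg v A σ‖) ≤ ‖siteAvg v A τ‖} with hD
  set T := n * m with hT
  set lam : ℝ := 1 / (512 * Q ^ 3) with hlam
  have hlam0 : 0 < lam := by positivity
  have hnlam : (n : ℝ) / (512 * Q ^ 3) = n * lam := by rw [hlam]; ring
  set err := (T : ℝ) * (p + (Real.exp (1 - n / (512 * Q ^ 3) * (1 / m ^ 2)) + T * p)) with herr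
  have herr0 : 0 ≤ err := by positivity
  have hexp : ∀ L : ℕ, Real.exp (-(2 * L / n) + 2 * (8 * Real.exp 1 * Q + 1) + 2) =
      Real.exp (-(2 * L / n)) * K := fun L => by
    rw [hK, ← Real.exp_add]
    congr 1
    ring
  set y := ‖siteAvg v A σ‖ with hy
  have hy0 : 0 ≤ y := norm_nonneg _
  have hDsq : ∀ τ, τ ∈ D →
      r ^ 2 * (1 / n + Real.exp (-(2 * t / n)) * y ^ 2) ≤ ‖siteAvg v A τ‖ ^ 2 := by
    intro τ hτ
    have hτ' : r * (1 / Real.sqrt n + Real.exp (-(t : ℝ) / n) * y) ≤ ‖siteAvg v A τ‖ := hτ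
    refine le_trans ?_ (pow_le_pow_left₀ (by positivity) hτ' 2)
    have e1 : (1 : ℝ) / n = (1 / Real.sqrt n) ^ 2 := by
      rw [div_pow, Real.sq_sqrt hn0.le, one_pow]
    have e2 : Real.exp (-(2 * t / n)) = Real.exp (-(t : ℝ) / n) ^ 2 := by
      rw [← Real.exp_nat_mul]
      congr 1
      push_cast
      ring
    rw [e1, e2, mul_pow]
    refine mul_le_mul_of_nonneg_left ?_ (sq_nonneg r)
    have : 0 ≤ 2 * (1 / Real.sqrt n) * (Real.exp (-(t : ℝ) / n) * y) := by positivity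
    nlinarith
  have hmom := fun (t₀ L : ℕ) (hL : L ≤ T) => sum_killed_slow_mul_exp_le (w := law G σ t₀)
    hn hR hinv hQ hv hiso hzero hmul hA (law_nonneg σ t₀) hm hL
  have hcover := fun (t₀ L : ℕ) (hL : L ≤ T) => prob_le_killed_slow_add (t := t₀) (b := 1 / m ^ 2)
    hn hR hinv hQ hv hiso hzero σ hp hL D
  simp only [hexp, hnlam] at hmom hcover
  rw [hnlam] at herr
  rcases le_or_gt t T with htT | htT
  · rcases le_or_gt K (r ^ 2) with hrK | hrK
    · have h1 := hcover 0 t htT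
      rw [zero_add, ← herr] at h1
      refine h1.trans (add_le_add ?_ le_rfl)
      refine (sum_filter_le_exp_mul (f := fun τ => n * lam * ‖siteAvg v A τ‖ ^ 2)
        (killed_nonneg (law_nonneg σ 0) t)
        (fun τ hτ => mul_le_mul_of_nonneg_left (hDsq τ hτ) (by positivity))).trans ?_
      refine (mul_le_mul_of_nonneg_left (hmom 0 t htT) (Real.exp_pos _).le).trans ?_
      simp only [law, ite_mul, one_mul, zero_mul, Finset.sum_ite_eq', Finset.mem_univ, if_true]
      rw [← hy, ← Real.exp_add, ← Real.exp_add, ← Real.exp_add, Real.exp_le_exp]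
      have e : n * lam * (r ^ 2 * (1 / n + Real.exp (-(2 * t / n)) * y ^ 2)) =
          lam * r ^ 2 + n * lam * (Real.exp (-(2 * t / n)) * r ^ 2) * y ^ 2 := by
        field_simp
      rw [e]
      have h2 : n * lam * (Real.exp (-(2 * t / n)) * K) * y ^ 2 ≤
          n * lam * (Real.exp (-(2 * t / n)) * r ^ 2) * y ^ 2 := by gcongr
      have h3 : 0 ≤ lam * K * Q := by positivity
      linarith
    · refine (prob_le_one hn σ t D).trans (le_add_of_le_of_nonneg ?_ herr0)
      rw [← Real.exp_add, Real.one_le_exp_iff]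
      have h2 : lam * r ^ 2 ≤ lam * (K * Q) := by
        refine mul_le_mul_of_nonneg_left ?_ hlam0.le
        nlinarith
      linarith
  · obtain ⟨t₀, rfl⟩ : ∃ t₀, t = t₀ + T := ⟨t - T, by omega⟩
    have h1 := hcover t₀ T le_rfl
    rw [← herr] at h1
    refine h1.trans (add_le_add ?_ le_rfl)
    refine (sum_filter_le_exp_mul (f := fun τ => n * lam * ‖siteAvg v A τ‖ ^ 2)
      (c := n * lam * (r ^ 2 * (1 / n))) (killed_nonneg (law_nonneg σ t₀) T)
      (fun τ hτ => mul_le_mul_of_nonneg_left (le_trans ?_ (hDsq τ hτ)) (by positivity))).trans ?_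
    · refine mul_le_mul_of_nonneg_left (le_add_of_nonneg_right ?_) (sq_nonneg r)
      positivity
    refine (mul_le_mul_of_nonneg_left ((hmom t₀ T le_rfl).trans (mul_le_mul_of_nonneg_left
      (sum_law_mul_exp_norm_siteAvg_le hn hQ0.le hv (by positivity) σ t₀) (Real.exp_pos _).le))
      (Real.exp_pos _).le).trans ?_
    rw [← Real.exp_add, ← Real.exp_add, ← Real.exp_add, Real.exp_le_exp]
    have e : n * lam * (r ^ 2 * (1 / n)) = lam * r ^ 2 := by field_simp
    have h2 : n * Real.exp (-(2 * T / n)) ≤ 1 := by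
      have h3 : (T : ℝ) = n * m := by rw [hT]; push_cast; ring
      have h4 : -(2 * (T : ℝ) / n) = -(2 * m) := by rw [h3]; field_simp
      have hm0 : (0 : ℝ) ≤ m := Nat.cast_nonneg m
      rw [h4]
      calc (n : ℝ) * Real.exp (-(2 * m)) = Real.exp (Real.log n) * Real.exp (-(2 * m)) := by
            rw [Real.exp_log hn0]
        _ ≤ 1 := by
            rw [← Real.exp_add, Real.exp_le_one_iff]
            linarith
    have h5 : n * lam * (Real.exp (-(2 * T / n)) * K) * Q ≤ lam * K * Q := by
      have : 0 ≤ lam * K * Q := by positivity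
      calc n * lam * (Real.exp (-(2 * T / n)) * K) * Q =
          (n * Real.exp (-(2 * T / n))) * (lam * K * Q) := by ring
        _ ≤ 1 * (lam * K * Q) := mul_le_mul_of_nonneg_right h2 this
        _ = _ := one_mul _
    rw [e]
    linarith

end Decay

end PR

namespace PR

section Asymptotics

theorem eventually_natCeil_log_sq_le :
    ∀ᶠ n : ℕ in atTop, ((⌈Real.log n⌉₊ + 1 : ℕ) : ℝ) ^ 2 ≤ Real.sqrt n := by
  have h := (isLittleO_log_rpow_atTop (show (0 : ℝ) < 1 / 4 by norm_num)).bound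
    (show (0 : ℝ) < 1 / 2 by norm_num)
  have h' := tendsto_natCast_atTop_atTop (R := ℝ) |>.eventually h
  filter_upwards [h', eventually_ge_atTop 256] with n hn hn256
  have h256 : (256 : ℝ) ≤ n := by exact_mod_cast hn256
  have hn0 : (0 : ℝ) ≤ n := by linarith
  have hlog0 : 0 ≤ Real.log n := Real.log_nonneg (by linarith)
  set x : ℝ := (n : ℝ) ^ (1 / 4 : ℝ) with hx
  have hx0 : 0 ≤ x := Real.rpow_nonneg hn0 _
  have hx4 : x ^ 2 = Real.sqrt n := by
    rw [hx, ← Real.rpow_natCast, ← Real.rpow_mul hn0, Real.sqrt_eq_rpow]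
    norm_num
  have hx2 : (4 : ℝ) ≤ x := by
    have : (16 : ℝ) ≤ Real.sqrt n := by
      apply Real.le_sqrt_of_sq_le
      linarith
    nlinarith
  rw [Real.norm_of_nonneg hlog0, Real.norm_of_nonneg hx0] at hn
  have hc := (Nat.ceil_lt_add_one hlog0).le
  rw [← hx4]
  push_cast
  refine pow_le_pow_left₀ (by positivity) ?_ 2
  linarith

theorem tendsto_pow_mul_exp_neg_mul (k : ℕ) {c : ℝ} (hc : 0 < c) :
    Tendsto (fun x : ℝ => x ^ k * Real.exp (-(c * x))) atTop (nhds 0) := by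
  have := tendsto_rpow_mul_exp_neg_mul_atTop_nhds_zero k c hc
  simpa only [Real.rpow_natCast, neg_mul] using this

/-- The probability of leaving the good event over the whole time horizon is `O(n⁻³)`. -/
theorem eventually_error_le (k : ℕ) {c : ℝ} (hc : 0 < c) :
    ∀ᶠ n : ℕ in atTop,
      ((n * (⌈Real.log n⌉₊ + 1) : ℕ) : ℝ) *
        (2 ^ k * (Real.exp 1 * n) ^ k * Real.exp (-(n / 16)) +
          (Real.exp (1 - n / c * (1 / ((⌈Real.log n⌉₊ + 1 : ℕ) : ℝ) ^ 2)) +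
            ((n * (⌈Real.log n⌉₊ + 1) : ℕ) : ℝ) *
              (2 ^ k * (Real.exp 1 * n) ^ k * Real.exp (-(n / 16))))) ≤ 2 / (n : ℝ) ^ 3 := by
  have hcast := tendsto_natCast_atTop_atTop (R := ℝ)
  have hp : Tendsto (fun n : ℕ => (n : ℝ) ^ 3 * (2 * n ^ 4 *
      (2 ^ k * (Real.exp 1 * n) ^ k * Real.exp (-(n / 16))))) atTop (nhds 0) := by
    have h := ((tendsto_pow_mul_exp_neg_mul (7 + k) (show (0 : ℝ) < 1 / 16 by norm_num)).comp
      hcast).const_mul (2 * 2 ^ k * Real.exp 1 ^ k)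
    rw [mul_zero] at h
    refine h.congr fun n => ?_
    simp only [Function.comp]
    rw [mul_pow, pow_add, show (1 : ℝ) / 16 * n = n / 16 by ring]
    ring
  have hs : Tendsto (fun n : ℕ => (n : ℝ) ^ 3 * (n ^ 2 *
      Real.exp (1 - 1 / c * Real.sqrt n))) atTop (nhds 0) := by
    have h := ((tendsto_pow_mul_exp_neg_mul 10 (show (0 : ℝ) < 1 / c by positivity)).comp
      (Real.tendsto_sqrt_atTop.comp hcast)).const_mul (Real.exp 1)
    rw [mul_zero] at h
    refine h.congr fun n => ?_
    simp only [Function.comp]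
    have : Real.sqrt (n : ℝ) ^ 10 = (n : ℝ) ^ 5 := by
      rw [show 10 = 2 * 5 from rfl, pow_mul, Real.sq_sqrt (Nat.cast_nonneg n)]
    rw [this, sub_eq_add_neg, Real.exp_add]
    ring
  filter_upwards [hp.eventually_le_const one_pos, hs.eventually_le_const one_pos,
    eventually_natCeil_log_sq_le, eventually_ge_atTop 1] with n h1 h2 h3 h4
  have hn1 : (1 : ℝ) ≤ n := by exact_mod_cast h4
  have hn0 : (0 : ℝ) < n := by linarith
  set m := ⌈Real.log n⌉₊ + 1 with hm
  have hm1 : (1 : ℝ) ≤ m := by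
    rw [hm]; push_cast; linarith [(Nat.cast_nonneg ⌈Real.log n⌉₊ : (0 : ℝ) ≤ _)]
  set p : ℝ := 2 ^ k * (Real.exp 1 * n) ^ k * Real.exp (-(n / 16)) with hpd
  have hp0 : 0 ≤ p := by positivity
  have hsq : Real.sqrt n * Real.sqrt n = n := Real.mul_self_sqrt hn0.le
  have hs1 : 1 ≤ Real.sqrt n := Real.one_le_sqrt.2 hn1
  have hmn : (m : ℝ) ≤ n := by nlinarith
  have hT : ((n * m : ℕ) : ℝ) ≤ n ^ 2 := by
    push_cast
    nlinarith
  have hT0 : (0 : ℝ) ≤ ((n * m : ℕ) : ℝ) := Nat.cast_nonneg _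
  have he : Real.exp (1 - n / c * (1 / (m : ℝ) ^ 2)) ≤ Real.exp (1 - 1 / c * Real.sqrt n) := by
    rw [Real.exp_le_exp]
    have : Real.sqrt n ≤ n * (1 / (m : ℝ) ^ 2) := by
      rw [mul_one_div, le_div_iff₀ (by positivity)]
      calc Real.sqrt n * (m : ℝ) ^ 2 ≤ Real.sqrt n * Real.sqrt n := by gcongr
        _ = n := hsq
    have h6 : 1 / c * Real.sqrt n ≤ 1 / c * (n * (1 / (m : ℝ) ^ 2)) := by gcongr
    have h7 : 1 / c * (n * (1 / (m : ℝ) ^ 2)) = n / c * (1 / (m : ℝ) ^ 2) := by ring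
    linarith
  set e := Real.exp (1 - 1 / c * Real.sqrt n) with hed
  rw [le_div_iff₀ (by positivity)]
  have hn24 : (n : ℝ) ^ 2 ≤ n ^ 4 := pow_le_pow_right₀ hn1 (by norm_num)
  calc ((n * m : ℕ) : ℝ) * (p + (Real.exp (1 - n / c * (1 / (m : ℝ) ^ 2)) + (n * m : ℕ) * p)) *
        (n : ℝ) ^ 3 ≤ n ^ 2 * (p + (e + n ^ 2 * p)) * n ^ 3 := by
        gcongr
    _ = n ^ 2 * p * n ^ 3 + n ^ 3 * (n ^ 2 * e) + n ^ 4 * p * n ^ 3 := by ring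
    _ ≤ n ^ 4 * p * n ^ 3 + n ^ 3 * (n ^ 2 * e) + n ^ 4 * p * n ^ 3 := by gcongr
    _ = n ^ 3 * (2 * n ^ 4 * p) + n ^ 3 * (n ^ 2 * e) := by ring
    _ ≤ 1 + 1 := add_le_add h1 h2
    _ = 2 := by norm_num

end Asymptotics

section Typical

variable {G : Type} [Group G] [Fintype G] {n : ℕ}

theorem sum_sq_le_of_mem_SAst {σ : Config G n} {δ : ℝ} (hδ : 0 ≤ δ) (hσ : σ ∈ SAst G n δ) :
    ∑ a, ((nCount G σ a : ℝ) / n - 1 / (Fintype.card G : ℝ)) ^ 2 ≤ δ ^ 2 :=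
  (Real.sqrt_le_left hδ).1 hσ.2

theorem le_two_mul_nCount (hn : 1 ≤ n) {σ : Config G n}
    (hσ : σ ∈ SAst G n (1 / (4 * (Fintype.card G : ℝ)))) (a : G) :
    (n : ℝ) ≤ 2 * Fintype.card G * nCount G σ a := by
  have hn0 : (0 : ℝ) < n := by exact_mod_cast hn
  have hQ : (0 : ℝ) < Fintype.card G := by exact_mod_cast Fintype.card_pos
  have h := (Finset.single_le_sum
    (f := fun a => ((nCount G σ a : ℝ) / n - 1 / (Fintype.card G : ℝ)) ^ 2)
    (fun _ _ => sq_nonneg _) (Finset.mem_univ a)).trans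
      (sum_sq_le_of_mem_SAst (by positivity) hσ)
  have h1 := (abs_le_of_sq_le_sq' h (by positivity)).1
  have h2 : 3 / (4 * (Fintype.card G : ℝ)) ≤ nCount G σ a / n := by
    have : (3 : ℝ) / (4 * Fintype.card G) =
      1 / (Fintype.card G : ℝ) - 1 / (4 * Fintype.card G) := by field_simp; norm_num
    linarith
  rw [div_le_div_iff₀ (by positivity) hn0] at h2
  nlinarith

end Typical

end PR

/-- Lemma 3.5: for any `σ_*, σ'_* ∈ S_*(1/(4Q))`, there are constants
`c_G, C_G > 0` depending only on `G` such that for all large enough `n`, all `a ∈ G`,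
all non-trivial irreducible unitary `ρ ∈ G^*`, all `t ≥ 0` and all `R > 0`,
`Pr_{σ'_*}(‖y^{σ_*}_{a,ρ}(t)‖_HS ≥ R(1/√n + e^{−t/n} ‖y^{σ_*}_{a,ρ}(0)‖_HS))
  ≤ C_G e^{−c_G R²} + 2/n³`. -/
theorem matrix_fourier_coefficient_decay
    (G : Type) [Group G] [Fintype G] :
    ∃ c C : ℝ, 0 < c ∧ 0 < C ∧ ∃ N : ℕ, ∀ n : ℕ, N ≤ n →
      ∀ (d : ℕ) (ρ : PR.UnitaryRep G d),
        PR.IsNontrivialRep G ρ → PR.IsIrreducibleRep G ρ →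
        ∀ σast ∈ PR.SAst G n (1 / (4 * (Fintype.card G : ℝ))),
        ∀ σast' ∈ PR.SAst G n (1 / (4 * (Fintype.card G : ℝ))),
        ∀ (a : G) (t : ℕ) (R : ℝ), 0 < R →
          PR.prob G σast' t
            {τ | R * (1 / Real.sqrt n +
                Real.exp (-(t : ℝ) / n) * PR.hsNorm (PR.yCoeff G ρ σast σast' a))
              ≤ PR.hsNorm (PR.yCoeff G ρ σast τ a)}
          ≤ C * Real.exp (-(c * R ^ 2)) + 2 / (n : ℝ) ^ 3 := by
  set Q : ℝ := (Fintype.card G : ℝ) with hQd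
  have hQ1 : (1 : ℝ) ≤ Q := Nat.one_le_cast.2 Fintype.card_pos
  have hQ0 : 0 < Q := by linarith
  obtain ⟨N, hN⟩ := eventually_atTop.1 (PR.eventually_error_le (Fintype.card G)
    (show (0 : ℝ) < 512 * Q ^ 3 by positivity))
  refine ⟨1 / (512 * Q ^ 3), Real.exp (1 + 1 / (512 * Q ^ 3) *
    Real.exp (2 * (8 * Real.exp 1 * Q + 1) + 2) * Q), by positivity, Real.exp_pos _, max N 2, ?_⟩
  intro n hn d ρ hnt hirr σast hσast σast' hσast' a t r hr
  have hn2 : 2 ≤ n := le_of_max_le_right hn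
  let U : G → Matrix (Fin d) (Fin d) ℂ := fun g => (ρ g : Matrix (Fin d) (Fin d) ℂ)
  have hp := PR.prob_atypical_le hn2 σast' ((PR.sum_sq_le_of_mem_SAst (by positivity) hσast').trans
    (by
      rw [← hQd, div_pow, one_pow]
      exact one_div_le_one_div_of_le (by positivity) (by nlinarith)))
  have hUinv : ∀ h, U h⁻¹ = (U h).conjTranspose := fun h => by
    simp only [U, map_inv]
    rfl
  have key := PR.prob_norm_siteAvg_ge_le (v := fun g => PR.toHS (U g))
    (R := fun h => PR.hsMulRight (U h)) (A := Finset.univ.filter fun i => σast i = a) hn2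
    (fun g h => by
      rw [PR.hsMulRight_toHS]
      simp [U])
    (fun h w => by rw [hUinv, PR.inner_hsMulRight_conjTranspose]) hQ1
    (fun g => by
      rw [PR.norm_toHS_rep_sq, hQd]
      exact_mod_cast PR.dim_le_card ρ hirr)
    (fun h w => (PR.norm_hsMulRight (ρ h) w).le)
    (fun w => by
      have : ∑ h, PR.hsMulRight (U h) w = PR.toHS (PR.ofHS w * ∑ h, U h) := by
        rw [Finset.mul_sum, map_sum]
        rfl
      rw [this, PR.sum_rep_eq_zero ρ hnt hirr, mul_zero, map_zero])
    (fun σ w => PR.sum_inner_hsMulRight_le ρ (by omega) σ w)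
    (PR.le_two_mul_nCount (by omega) hσast a) σast' hp
    (m := ⌈Real.log n⌉₊ + 1) (by omega)
    ((Nat.le_ceil _).trans (by push_cast; linarith)) rfl t hr
  simp only [U, ← PR.toHS_yCoeff, PR.norm_toHS] at key
  exact key.trans (add_le_add le_rfl (hN n (le_of_max_le_left hn)))
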